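/- arXiv:2008.10901 — 10 statements merged into one kernel-verified Lean document; each statement's English description precedes it below -/
import Mathlib

section
/- Fixed-beamformer sum-power duality for Case I: Suppose ū_1,…,ū_K ∈ ℂ^M are unit vectors with Σ_{k=1}^K |ū_{k,m}|² > 0 for every m, and let R_k > 0 (k = 1,…,K) and C_m > 0 (m = 1,…,M). Consider the uplink problem: minimize Σ_{k=1}^K p_k over p ∈ ℝ_{≥0}^K, q ∈ ℝ_{>0}^M subject to R_k^{ul,TIN}(p,ū,q) ≥ R_k for all k and C_m^{ul,IN}(p,q) ≤ C_m for all m; and the downlink problem: minimize Σ_{k=1}^K p_k + Σ_{m=1}^M q_m over p ∈ ℝ_{≥0}^K, q ∈ ℝ_{>0}^M subject to R_k^{dl,LIN}(p,ū,q) ≥ R_k for all k and C_m^{dl,IN}(p,ū,q) ≤ C_m for all m. If both problems admit strictly feasible points (points satisfying all rate and fronthaul constraints with strict inequality), then the infima of the two problems are equal. -/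
open Finset Matrix

noncomputable section

namespace Stmt4

/-- Hermitian inner product `x^H y`. -/
def dotH {M : ℕ} (x y : Fin M → ℂ) : ℂ := ∑ m, (starRingEnd ℂ) (x m) * y m

/-- channel vector of user `k` (column of the `M × K` uplink channel matrix). -/
def hvec {M K : ℕ} (h : Fin M → Fin K → ℂ) (k : Fin K) : Fin M → ℂ := fun m => h m k

/-- uplink TIN rate of user `k`. -/
def RulTIN {M K : ℕ} (h : Fin M → Fin K → ℂ) (σ2 : ℝ) (p : Fin K → ℝ)
    (w : Fin K → Fin M → ℂ) (q : Fin M → ℝ) (k : Fin K) : ℝ :=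
  Real.logb 2
    ((∑ i, p i * Complex.normSq (dotH (w k) (hvec h i)) +
        ∑ m, q m * Complex.normSq (w k m) + σ2) /
      (∑ j ∈ Finset.univ.erase k, p j * Complex.normSq (dotH (w k) (hvec h j)) +
        ∑ m, q m * Complex.normSq (w k m) + σ2))

/-- uplink fronthaul rate of relay `m` under independent compression. -/
def CulIN {M K : ℕ} (h : Fin M → Fin K → ℂ) (σ2 : ℝ) (p : Fin K → ℝ)
    (q : Fin M → ℝ) (m : Fin M) : ℝ :=
  Real.logb 2 ((∑ k, p k * Complex.normSq (h m k) + q m + σ2) / q m)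

/-- downlink linear-encoding rate of user `k` (diagonal quantization noise `q`). -/
def RdlLIN {M K : ℕ} (h : Fin M → Fin K → ℂ) (σ2 : ℝ) (p : Fin K → ℝ)
    (v : Fin K → Fin M → ℂ) (q : Fin M → ℝ) (k : Fin K) : ℝ :=
  Real.logb 2
    ((∑ i, p i * Complex.normSq (dotH (v i) (hvec h k)) +
        ∑ m, q m * Complex.normSq (h m k) + σ2) /
      (∑ j ∈ Finset.univ.erase k, p j * Complex.normSq (dotH (v j) (hvec h k)) +
        ∑ m, q m * Complex.normSq (h m k) + σ2))

/-- downlink fronthaul rate of relay `m` under independent compression. -/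
def CdlIN {M K : ℕ} (p : Fin K → ℝ) (v : Fin K → Fin M → ℂ) (q : Fin M → ℝ)
    (m : Fin M) : ℝ :=
  Real.logb 2 ((∑ k, p k * Complex.normSq (v k m) + q m) / q m)

/-- A nonnegative vector whose image under a matrix with nonpositive off-diagonal entries is positive at `i`
is itself positive at `i`. -/
lemma pos_of_mulVec_pos {ι : Type*} [Fintype ι] {A : Matrix ι ι ℝ}
    (hA : ∀ i j, i ≠ j → A i j ≤ 0) {x : ι → ℝ} (hx : 0 ≤ x) {i : ι} (hi : 0 < (A *ᵥ x) i) :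
    0 < x i := by
  refine lt_of_le_of_ne (hx i) fun h0 => hi.not_ge ?_
  refine Finset.sum_nonpos fun j _ => ?_
  by_cases hij : i = j
  · subst hij
    simp [← h0]
  · exact mul_nonpos_of_nonpos_of_nonneg (hA i j hij) (hx j)

/-- A matrix with nonpositive off-diagonal entries mapping some nonnegative vector to a
positive one is inverse-positive. -/
lemma nonneg_of_mulVec_nonneg {ι : Type*} [Fintype ι] {A : Matrix ι ι ℝ}
    (hA : ∀ i j, i ≠ j → A i j ≤ 0) {x : ι → ℝ} (hx : 0 ≤ x) (hAx : ∀ i, 0 < (A *ᵥ x) i)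
    {z : ι → ℝ} (hz : 0 ≤ A *ᵥ z) : 0 ≤ z := by
  have hpos : ∀ i, 0 < x i := fun i => pos_of_mulVec_pos hA hx (hAx i)
  intro i₀
  by_contra! hneg
  simp only [Pi.zero_apply] at hneg
  obtain ⟨i, -, hi⟩ := Finset.exists_min_image Finset.univ (fun i => z i / x i) ⟨i₀, by simp⟩
  have ht : z i / x i < 0 :=
    (hi i₀ (Finset.mem_univ _)).trans_lt (div_neg_of_neg_of_pos hneg (hpos i₀))
  have hw : 0 ≤ z - (z i / x i) • x := fun j => by
    simpa using (le_div_iff₀ (hpos j)).1 (hi j (Finset.mem_univ _))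
  have hAw : 0 < (A *ᵥ (z - (z i / x i) • x)) i := by
    rw [Matrix.mulVec_sub, Matrix.mulVec_smul]
    simp only [Pi.sub_apply, Pi.smul_apply, smul_eq_mul]
    have h1 : 0 ≤ (A *ᵥ z) i := hz i
    linarith [mul_neg_of_neg_of_pos ht (hAx i)]
  have := pos_of_mulVec_pos hA hw hAw
  simp [(hpos i).ne'] at this

/-- The linear programs `min e ⬝ x, A x ≥ c` and `min c ⬝ y, Aᵀ y ≥ e` over nonnegative vectors
are solved by `A⁻¹ c` and `A⁻ᵀ e`, which are least feasible points and give equal values. -/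
lemma exists_least_solutions {ι : Type*} [Fintype ι] [DecidableEq ι] {A : Matrix ι ι ℝ}
    (hA : ∀ i j, i ≠ j → A i j ≤ 0) {x : ι → ℝ} (hx : 0 ≤ x) (hAx : ∀ i, 0 < (A *ᵥ x) i)
    {c e : ι → ℝ} (hc : 0 ≤ c) (he : 0 ≤ e) :
    ∃ x₀ y₀ : ι → ℝ, 0 ≤ x₀ ∧ 0 ≤ y₀ ∧ A *ᵥ x₀ = c ∧ Aᵀ *ᵥ y₀ = e ∧
      (∀ z, c ≤ A *ᵥ z → x₀ ≤ z) ∧ (∀ z, e ≤ Aᵀ *ᵥ z → y₀ ≤ z) ∧ e ⬝ᵥ x₀ = c ⬝ᵥ y₀ := by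
  have mono : ∀ z, 0 ≤ A *ᵥ z → 0 ≤ z := fun z => nonneg_of_mulVec_nonneg hA hx hAx
  have inj : Function.Injective A.mulVec := by
    intro v w hvw
    have hvw : A *ᵥ v = A *ᵥ w := hvw
    refine le_antisymm ?_ ?_ <;> rw [← sub_nonneg] <;> apply mono <;>
      simp [Matrix.mulVec_sub, hvw]
  have hdet : IsUnit A.det :=
    (Matrix.isUnit_iff_isUnit_det A).1 (Matrix.mulVec_injective_iff_isUnit.1 inj)
  have hinv : ∀ v, A *ᵥ (A⁻¹ *ᵥ v) = v := fun v => by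
    rw [Matrix.mulVec_mulVec, Matrix.mul_nonsing_inv _ hdet, Matrix.one_mulVec]
  have hinvT : ∀ v, Aᵀ *ᵥ (Aᵀ⁻¹ *ᵥ v) = v := fun v => by
    rw [Matrix.mulVec_mulVec, Matrix.mul_nonsing_inv _ (by rwa [Matrix.det_transpose]),
      Matrix.one_mulVec]
  have adj : ∀ v w, (Aᵀ *ᵥ v) ⬝ᵥ w = v ⬝ᵥ (A *ᵥ w) := fun v w => by
    rw [Matrix.mulVec_transpose, Matrix.dotProduct_mulVec]
  have monoT : ∀ z, 0 ≤ Aᵀ *ᵥ z → 0 ≤ z := by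
    intro z hz i
    have hw : 0 ≤ A⁻¹ *ᵥ Pi.single i (1 : ℝ) :=
      mono _ (by rw [hinv]; exact Pi.single_nonneg.2 zero_le_one)
    have := dotProduct_nonneg_of_nonneg hz hw
    rwa [adj, hinv, dotProduct_single, mul_one] at this
  refine ⟨A⁻¹ *ᵥ c, Aᵀ⁻¹ *ᵥ e, mono _ (by rwa [hinv]), monoT _ (by rwa [hinvT]), hinv c,
    hinvT e, fun z hz => ?_, fun z hz => ?_, ?_⟩
  · rw [← sub_nonneg]
    exact mono _ (by rw [Matrix.mulVec_sub, hinv]; exact sub_nonneg.2 hz)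
  · rw [← sub_nonneg]
    exact monoT _ (by rw [Matrix.mulVec_sub, hinvT]; exact sub_nonneg.2 hz)
  · conv_lhs => rw [← hinvT e]
    rw [adj, hinv, dotProduct_comm]

/-- A rate constraint with signal and interference gains `g` as a linear constraint. -/
lemma le_logb_sinr_iff {ι : Type*} [Fintype ι] [DecidableEq ι] {p g r : ι → ℝ} {k : ι}
    {n s R : ℝ} (hp : ∀ i, 0 ≤ p i) (hg : ∀ i, 0 ≤ g i) (hn : 0 ≤ n) (hs : 0 < s) (hR : 0 < R)
    (hk : r k = g k / ((2 : ℝ) ^ R - 1)) (hr : ∀ j, j ≠ k → r j = -g j) :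
    R ≤ Real.logb 2 ((∑ i, p i * g i + n + s) /
      (∑ j ∈ Finset.univ.erase k, p j * g j + n + s)) ↔ s ≤ r ⬝ᵥ p - n := by
  have ha : 0 < (2 : ℝ) ^ R - 1 := sub_pos.2 (Real.one_lt_rpow one_lt_two hR)
  have hI : 0 ≤ ∑ j ∈ Finset.univ.erase k, p j * g j :=
    Finset.sum_nonneg fun j _ => mul_nonneg (hp j) (hg j)
  have hS : ∑ i, p i * g i = p k * g k + ∑ j ∈ Finset.univ.erase k, p j * g j :=
    (Finset.add_sum_erase _ _ (Finset.mem_univ k)).symm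
  have hrow : r ⬝ᵥ p = p k * g k / ((2 : ℝ) ^ R - 1) -
      ∑ j ∈ Finset.univ.erase k, p j * g j := by
    rw [dotProduct, ← Finset.add_sum_erase _ _ (Finset.mem_univ k), hk,
      Finset.sum_congr rfl fun j hj => by rw [hr j (Finset.ne_of_mem_erase hj), neg_mul, mul_comm],
      Finset.sum_neg_distrib]
    ring
  have hpg := mul_nonneg (hp k) (hg k)
  rw [Real.le_logb_iff_rpow_le one_lt_two (div_pos (by rw [hS]; linarith) (by linarith)),
    le_div_iff₀ (by linarith), hS, hrow]
  have key : s ≤ p k * g k / ((2 : ℝ) ^ R - 1) -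
      ∑ j ∈ Finset.univ.erase k, p j * g j - n ↔
      ∑ j ∈ Finset.univ.erase k, p j * g j + n + s ≤ p k * g k / ((2 : ℝ) ^ R - 1) := by
    constructor <;> intro h <;> linarith
  rw [key, le_div_iff₀ ha]
  constructor <;> intro h <;> nlinarith

lemma logb_div_le_iff {q t C : ℝ} (hq : 0 < q) (ht : 0 ≤ t) :
    Real.logb 2 ((t + q) / q) ≤ C ↔ t ≤ ((2 : ℝ) ^ C - 1) * q := by
  rw [Real.logb_le_iff_le_rpow one_lt_two (by positivity), div_le_iff₀ hq]
  constructor <;> intro h <;> linarith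

section LinearConstraints

variable {M K : ℕ} (h : Fin M → Fin K → ℂ) (u : Fin K → Fin M → ℂ) (R : Fin K → ℝ)
  (C : Fin M → ℝ)

/-- The matrix whose rows are the linearized uplink rate and fronthaul constraints; its transpose
plays the same role for the downlink. -/
def constraintMatrix : Matrix (Fin K ⊕ Fin M) (Fin K ⊕ Fin M) ℝ :=
  Matrix.fromBlocks
    (Matrix.of fun k j => if j = k then
      Complex.normSq (dotH (u k) (hvec h k)) / ((2 : ℝ) ^ R k - 1)
      else -Complex.normSq (dotH (u k) (hvec h j)))
    (-Matrix.of fun k m => Complex.normSq (u k m))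
    (-Matrix.of fun m k => Complex.normSq (h m k))
    (Matrix.diagonal fun m => (2 : ℝ) ^ C m - 1)

lemma constraintMatrix_nonpos (i j : Fin K ⊕ Fin M) (hij : i ≠ j) :
    constraintMatrix h u R C i j ≤ 0 := by
  rcases i with k | m <;> rcases j with j | n
  · have : j ≠ k := fun e => hij (by rw [e])
    simp [constraintMatrix, this, Complex.normSq_nonneg]
  · simp [constraintMatrix, Complex.normSq_nonneg]
  · simp [constraintMatrix, Complex.normSq_nonneg]
  · have : m ≠ n := fun e => hij (by rw [e])
    simp [constraintMatrix, this]

variable {R} {p : Fin K → ℝ} {q : Fin M → ℝ} {σ2 : ℝ}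

lemma le_RulTIN_iff (hσ : 0 < σ2) (hp : ∀ k, 0 ≤ p k) (hq : ∀ m, 0 ≤ q m) (hR : ∀ k, 0 < R k)
    (k : Fin K) : R k ≤ RulTIN h σ2 p u q k ↔
      σ2 ≤ (constraintMatrix h u R C *ᵥ Sum.elim p q) (Sum.inl k) := by
  rw [RulTIN, le_logb_sinr_iff (r := fun j => constraintMatrix h u R C (Sum.inl k) (Sum.inl j))
    hp (fun _ => Complex.normSq_nonneg _)
    (Finset.sum_nonneg fun m _ => mul_nonneg (hq m) (Complex.normSq_nonneg _)) hσ (hR k)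
    (by simp [constraintMatrix]) (fun j hj => by simp [constraintMatrix, hj])]
  simp [Matrix.mulVec, dotProduct, constraintMatrix, sub_eq_add_neg, mul_comm]

lemma le_RdlLIN_iff (hσ : 0 < σ2) (hp : ∀ k, 0 ≤ p k) (hq : ∀ m, 0 ≤ q m) (hR : ∀ k, 0 < R k)
    (k : Fin K) : R k ≤ RdlLIN h σ2 p u q k ↔
      σ2 ≤ ((constraintMatrix h u R C)ᵀ *ᵥ Sum.elim p q) (Sum.inl k) := by
  rw [RdlLIN, le_logb_sinr_iff (r := fun j => constraintMatrix h u R C (Sum.inl j) (Sum.inl k))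
    hp (fun _ => Complex.normSq_nonneg _)
    (Finset.sum_nonneg fun m _ => mul_nonneg (hq m) (Complex.normSq_nonneg _)) hσ (hR k)
    (by simp [constraintMatrix]) (fun j hj => by simp [constraintMatrix, hj.symm])]
  simp [Matrix.mulVec, dotProduct, constraintMatrix, sub_eq_add_neg, mul_comm]

variable (R)

lemma CulIN_le_iff (hσ : 0 < σ2) (hp : ∀ k, 0 ≤ p k) (hq : ∀ m, 0 < q m) (m : Fin M) :
    CulIN h σ2 p q m ≤ C m ↔
      σ2 ≤ (constraintMatrix h u R C *ᵥ Sum.elim p q) (Sum.inr m) := by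
  have ht : 0 ≤ ∑ k, p k * Complex.normSq (h m k) :=
    Finset.sum_nonneg fun k _ => mul_nonneg (hp k) (Complex.normSq_nonneg _)
  have hrow : (constraintMatrix h u R C *ᵥ Sum.elim p q) (Sum.inr m) =
      ((2 : ℝ) ^ C m - 1) * q m - ∑ k, p k * Complex.normSq (h m k) := by
    simp [Matrix.mulVec, dotProduct, constraintMatrix, Matrix.diagonal_apply, mul_comm]
    ring
  rw [CulIN, add_right_comm, logb_div_le_iff (hq m) (by linarith), hrow, le_sub_iff_add_le']

lemma transpose_constraintMatrix_mulVec_inr (m : Fin M) :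
    ((constraintMatrix h u R C)ᵀ *ᵥ Sum.elim p q) (Sum.inr m) =
      ((2 : ℝ) ^ C m - 1) * q m - ∑ k, p k * Complex.normSq (u k m) := by
  simp [Matrix.mulVec, dotProduct, constraintMatrix, Matrix.diagonal_apply, mul_comm]
  ring

lemma CdlIN_le_iff (hp : ∀ k, 0 ≤ p k) (hq : ∀ m, 0 < q m) (m : Fin M) :
    CdlIN p u q m ≤ C m ↔
      0 ≤ ((constraintMatrix h u R C)ᵀ *ᵥ Sum.elim p q) (Sum.inr m) := by
  rw [CdlIN, logb_div_le_iff (hq m)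
    (Finset.sum_nonneg fun k _ => mul_nonneg (hp k) (Complex.normSq_nonneg _)),
    transpose_constraintMatrix_mulVec_inr, sub_nonneg]

end LinearConstraints

/-- **Fixed-beamformer sum-power duality for Case I**: with the same fixed unit
beamformers `u` in the uplink and downlink, under the same rate targets `R` and
fronthaul targets `C`, if both sum-power minimization problems are strictly feasible
then their optimal values coincide. -/
theorem fixed_beamformer_sum_power_duality_caseI
    (M K : ℕ) (h : Fin M → Fin K → ℂ) (σ2 : ℝ) (hσ : 0 < σ2)
    (u : Fin K → Fin M → ℂ) (hu : ∀ k, ∑ m, Complex.normSq (u k m) = 1)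
    (hcov : ∀ m, 0 < ∑ k, Complex.normSq (u k m))
    (R : Fin K → ℝ) (hR : ∀ k, 0 < R k) (C : Fin M → ℝ) (hC : ∀ m, 0 < C m)
    (hULstrict : ∃ (p : Fin K → ℝ) (q : Fin M → ℝ),
      (∀ k, 0 ≤ p k) ∧ (∀ m, 0 < q m) ∧
      (∀ k, R k < RulTIN h σ2 p u q k) ∧ (∀ m, CulIN h σ2 p q m < C m))
    (hDLstrict : ∃ (p : Fin K → ℝ) (q : Fin M → ℝ),
      (∀ k, 0 ≤ p k) ∧ (∀ m, 0 < q m) ∧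
      (∀ k, R k < RdlLIN h σ2 p u q k) ∧ (∀ m, CdlIN p u q m < C m)) :
    sInf {x : ℝ | ∃ (p : Fin K → ℝ) (q : Fin M → ℝ),
        (∀ k, 0 ≤ p k) ∧ (∀ m, 0 < q m) ∧
        (∀ k, R k ≤ RulTIN h σ2 p u q k) ∧ (∀ m, CulIN h σ2 p q m ≤ C m) ∧
        x = ∑ k, p k}
      = sInf {x : ℝ | ∃ (p : Fin K → ℝ) (q : Fin M → ℝ),
        (∀ k, 0 ≤ p k) ∧ (∀ m, 0 < q m) ∧
        (∀ k, R k ≤ RdlLIN h σ2 p u q k) ∧ (∀ m, CdlIN p u q m ≤ C m) ∧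
        x = ∑ k, p k + ∑ m, q m} := by
  have hb : ∀ m, 0 < (2 : ℝ) ^ C m - 1 := fun m =>
    sub_pos.2 (Real.one_lt_rpow one_lt_two (hC m))
  have hZ := constraintMatrix_nonpos h u R C
  obtain ⟨p, q, hp, hq, hRp, hCq⟩ := hULstrict
  obtain ⟨x, y, hx, hy, hAx, hAy, hxmin, hymin, hval⟩ :=
    exists_least_solutions hZ (x := Sum.elim p q) (Sum.forall.2 ⟨hp, fun m => (hq m).le⟩)
      (Sum.forall.2
        ⟨fun k => hσ.trans_le
          ((le_RulTIN_iff h u C hσ hp (fun m => (hq m).le) hR k).1 (hRp k).le),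
        fun m => hσ.trans_le ((CulIN_le_iff h u R C hσ hp hq m).1 (hCq m).le)⟩)
      (c := fun _ => σ2) (e := Sum.elim (fun _ => σ2) 0) (fun _ => hσ.le)
      (Sum.forall.2 ⟨fun _ => hσ.le, fun _ => le_rfl⟩)
  obtain ⟨p₁, q₁, rfl⟩ : ∃ p₁ q₁, x = Sum.elim p₁ q₁ := ⟨_, _, (Sum.elim_comp_inl_inr x).symm⟩
  obtain ⟨p₂, q₂, rfl⟩ : ∃ p₂ q₂, y = Sum.elim p₂ q₂ := ⟨_, _, (Sum.elim_comp_inl_inr y).symm⟩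
  have hxpos : ∀ i, 0 < Sum.elim p₁ q₁ i := fun i =>
    pos_of_mulVec_pos hZ hx (by rw [hAx]; exact hσ)
  have hp₁ : ∀ k, 0 ≤ p₁ k := fun k => hx (Sum.inl k)
  have hq₁ : ∀ m, 0 < q₁ m := fun m => hxpos (Sum.inr m)
  have hp₂ : ∀ k, 0 < p₂ k := fun k =>
    pos_of_mulVec_pos (A := (constraintMatrix h u R C)ᵀ) (fun i j hij => hZ j i hij.symm) hy
      (i := Sum.inl k) (by rw [hAy]; exact hσ)
  have hq₂ : ∀ m, 0 < q₂ m := fun m => by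
    have hrow := congrFun hAy (Sum.inr m)
    rw [transpose_constraintMatrix_mulVec_inr, Sum.elim_inr, Pi.zero_apply, sub_eq_zero] at hrow
    obtain ⟨k, -, hk⟩ := Finset.exists_lt_of_sum_lt
      (by simpa using hcov m : ∑ k : Fin K, (0 : ℝ) < ∑ k, Complex.normSq (u k m))
    refine pos_of_mul_pos_right (a := (2 : ℝ) ^ C m - 1) ?_ (hb m).le
    rw [hrow]
    exact Finset.sum_pos' (fun j _ => mul_nonneg (hp₂ j).le (Complex.normSq_nonneg _))
      ⟨k, Finset.mem_univ k, mul_pos (hp₂ k) hk⟩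
  have hsum : ∑ k, p₁ k = ∑ k, p₂ k + ∑ m, q₂ m := by
    simp only [dotProduct, Fintype.sum_sum_type, Sum.elim_inl, Sum.elim_inr, Pi.zero_apply,
      zero_mul, Finset.sum_const_zero, add_zero, ← Finset.mul_sum] at hval
    exact mul_left_cancel₀ hσ.ne' hval
  have hUL : IsLeast {x : ℝ | ∃ (p : Fin K → ℝ) (q : Fin M → ℝ),
      (∀ k, 0 ≤ p k) ∧ (∀ m, 0 < q m) ∧
      (∀ k, R k ≤ RulTIN h σ2 p u q k) ∧ (∀ m, CulIN h σ2 p q m ≤ C m) ∧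
      x = ∑ k, p k} (∑ k, p₁ k) := by
    constructor
    · exact ⟨p₁, q₁, hp₁, hq₁,
        fun k => (le_RulTIN_iff h u C hσ hp₁ (fun m => (hq₁ m).le) hR k).2 (by rw [hAx]),
        fun m => (CulIN_le_iff h u R C hσ hp₁ hq₁ m).2 (by rw [hAx]), rfl⟩
    · rintro _ ⟨p, q, hp, hq, hRp, hCq, rfl⟩
      have hle := hxmin (Sum.elim p q) (Sum.forall.2
        ⟨fun k => (le_RulTIN_iff h u C hσ hp (fun m => (hq m).le) hR k).1 (hRp k),
        fun m => (CulIN_le_iff h u R C hσ hp hq m).1 (hCq m)⟩)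
      exact Finset.sum_le_sum fun k _ => hle (Sum.inl k)
  have hDL : IsLeast {x : ℝ | ∃ (p : Fin K → ℝ) (q : Fin M → ℝ),
      (∀ k, 0 ≤ p k) ∧ (∀ m, 0 < q m) ∧
      (∀ k, R k ≤ RdlLIN h σ2 p u q k) ∧ (∀ m, CdlIN p u q m ≤ C m) ∧
      x = ∑ k, p k + ∑ m, q m} (∑ k, p₂ k + ∑ m, q₂ m) := by
    constructor
    · exact ⟨p₂, q₂, fun k => (hp₂ k).le, hq₂,
        fun k => (le_RdlLIN_iff h u C hσ (fun k => (hp₂ k).le) (fun m => (hq₂ m).le) hR k).2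
          (by rw [hAy]; rfl),
        fun m => (CdlIN_le_iff h u R C (fun k => (hp₂ k).le) hq₂ m).2 (by rw [hAy]; rfl), rfl⟩
    · rintro _ ⟨p, q, hp, hq, hRp, hCq, rfl⟩
      have hle := hymin (Sum.elim p q) (Sum.forall.2
        ⟨fun k => (le_RdlLIN_iff h u C hσ hp (fun m => (hq m).le) hR k).1 (hRp k),
        fun m => (CdlIN_le_iff h u R C hp hq m).1 (hCq m)⟩)
      exact add_le_add (Finset.sum_le_sum fun k _ => hle (Sum.inl k))
        (Finset.sum_le_sum fun m _ => hle (Sum.inr m))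
  rw [hUL.csInf_eq, hDL.csInf_eq, hsum]

end Stmt4
end
end

section
/- Uniqueness of the positive solution of the Case I equality system (Proposition 2): Assume R_k > 0 and ū_k^H h_k ≠ 0 for all k, and C_m > 0 for all m. Then there is at most one pair (β,λ) with β_k > 0 for all k and λ_m > 0 for all m satisfying simultaneously: Σ_{j≠k} β_j|ū_k^H h_j|² + Σ_{m=1}^M λ_m|ū_{k,m}|² + σ² = β_k|ū_k^H h_k|²/(2^{R_k}−1) for every k ∈ {1,…,K}, and Σ_{k=1}^K β_k|h_{k,m}|² + σ² = (2^{C_m}−1) λ_m for every m ∈ {1,…,M}. -/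
open Finset

noncomputable section

namespace Stmt6

/-- Hermitian inner product `x^H y`. -/
def dotH {M : ℕ} (x y : Fin M → ℂ) : ℂ := ∑ m, (starRingEnd ℂ) (x m) * y m

/-- channel vector of user `k` (column of the `M × K` uplink channel matrix). -/
def hvec {M K : ℕ} (h : Fin M → Fin K → ℂ) (k : Fin K) : Fin M → ℂ := fun m => h m k

/-- The Case I equality system with strictly positive variables. -/
def EqSystem {M K : ℕ} (h : Fin M → Fin K → ℂ) (σ2 : ℝ) (u : Fin K → Fin M → ℂ)
    (R : Fin K → ℝ) (C : Fin M → ℝ) (β : Fin K → ℝ) (lam : Fin M → ℝ) : Prop :=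
  (∀ k, 0 < β k) ∧ (∀ m, 0 < lam m) ∧
  (∀ k, ∑ j ∈ Finset.univ.erase k, β j * Complex.normSq (dotH (u k) (hvec h j)) +
      ∑ m, lam m * Complex.normSq (u k m) + σ2 =
      β k * Complex.normSq (dotH (u k) (hvec h k)) / ((2:ℝ) ^ (R k) - 1)) ∧
  (∀ m, ∑ k, β k * Complex.normSq (h m k) + σ2 = ((2:ℝ) ^ (C m) - 1) * lam m)

/-- Positive solutions of `A x + b = c x` with `A ≥ 0` and `b > 0` are comparable: compare the two
sides at an index where the ratio of the solutions is largest. -/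
theorem le_of_sum_add_eq_mul {ι : Type*} [Fintype ι] {A : ι → ι → ℝ} {b c x y : ι → ℝ}
    (hA : ∀ i j, 0 ≤ A i j) (hb : ∀ i, 0 < b i) (hy : ∀ i, 0 < y i)
    (hxe : ∀ i, ∑ j, A i j * x j + b i = c i * x i)
    (hye : ∀ i, ∑ j, A i j * y j + b i = c i * y i) : x ≤ y := by
  by_contra hle
  obtain ⟨l, hl⟩ : ∃ l, y l < x l := by simpa [Pi.le_def] using hle
  have : Nonempty ι := ⟨l⟩
  obtain ⟨i, hi⟩ := Finite.exists_max fun i => x i / y i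
  have ht : 1 < x i / y i := ((one_lt_div (hy l)).2 hl).trans_le (hi l)
  have hxi : x i = x i / y i * y i := (div_mul_cancel₀ _ (hy i).ne').symm
  set t := x i / y i
  have hsum : ∑ j, A i j * x j ≤ t * ∑ j, A i j * y j := by
    rw [Finset.mul_sum]
    refine Finset.sum_le_sum fun j _ => ?_
    rw [mul_left_comm]
    exact mul_le_mul_of_nonneg_left ((div_le_iff₀ (hy j)).1 (hi j)) (hA i j)
  have hx := hxe i
  rw [hxi, mul_left_comm, ← hye i] at hx
  linarith [mul_pos (sub_pos.2 ht) (hb i)]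

/-- A positive linear system `A x + b = c x` with `A ≥ 0`, `b > 0` has at most one solution. -/
theorem eq_of_sum_add_eq_mul {ι : Type*} [Fintype ι] {A : ι → ι → ℝ} {b c x y : ι → ℝ}
    (hA : ∀ i j, 0 ≤ A i j) (hb : ∀ i, 0 < b i) (hx : ∀ i, 0 < x i) (hy : ∀ i, 0 < y i)
    (hxe : ∀ i, ∑ j, A i j * x j + b i = c i * x i)
    (hye : ∀ i, ∑ j, A i j * y j + b i = c i * y i) : x = y :=
  le_antisymm (le_of_sum_add_eq_mul hA hb hy hxe hye) (le_of_sum_add_eq_mul hA hb hx hye hxe)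

/-- Nonnegative coefficients of the stacked system in the variables `(β, λ)`. -/
def stackedCoeff {M K : ℕ} (h : Fin M → Fin K → ℂ) (u : Fin K → Fin M → ℂ) :
    Fin K ⊕ Fin M → Fin K ⊕ Fin M → ℝ
  | .inl k, .inl j => Complex.normSq (dotH (u k) (hvec h j))
  | .inl k, .inr m => Complex.normSq (u k m)
  | .inr m, .inl k => Complex.normSq (h m k)
  | .inr _, .inr _ => 0

theorem stackedCoeff_nonneg {M K : ℕ} (h : Fin M → Fin K → ℂ) (u : Fin K → Fin M → ℂ)
    (i j : Fin K ⊕ Fin M) : 0 ≤ stackedCoeff h u i j := by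
  rcases i with i | i <;> rcases j with j | j <;> simp [stackedCoeff, Complex.normSq_nonneg]

theorem EqSystem.stacked {M K : ℕ} {h : Fin M → Fin K → ℂ} {σ2 : ℝ} {u : Fin K → Fin M → ℂ}
    {R : Fin K → ℝ} {C : Fin M → ℝ} {β : Fin K → ℝ} {lam : Fin M → ℝ}
    (hs : EqSystem h σ2 u R C β lam) (i : Fin K ⊕ Fin M) :
    ∑ j, stackedCoeff h u i j * Sum.elim β lam j + σ2 =
      Sum.elim (fun k => Complex.normSq (dotH (u k) (hvec h k)) / ((2 : ℝ) ^ R k - 1) +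
        Complex.normSq (dotH (u k) (hvec h k))) (fun m => (2 : ℝ) ^ C m - 1) i *
        Sum.elim β lam i := by
  obtain ⟨-, -, hβ, hlam⟩ := hs
  rcases i with k | m
  · have hk := hβ k
    rw [Finset.sum_erase_eq_sub (Finset.mem_univ k)] at hk
    simp only [Fintype.sum_sum_type, stackedCoeff, Sum.elim_inl, Sum.elim_inr,
      mul_comm (Complex.normSq _)]
    rw [add_mul, div_mul_eq_mul_div, mul_comm (Complex.normSq _)]
    linarith
  · simpa [Fintype.sum_sum_type, stackedCoeff, mul_comm (Complex.normSq _)] using hlam m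

theorem EqSystem.elim_pos {M K : ℕ} {h : Fin M → Fin K → ℂ} {σ2 : ℝ} {u : Fin K → Fin M → ℂ}
    {R : Fin K → ℝ} {C : Fin M → ℝ} {β : Fin K → ℝ} {lam : Fin M → ℝ}
    (hs : EqSystem h σ2 u R C β lam) (i : Fin K ⊕ Fin M) : 0 < Sum.elim β lam i :=
  Sum.rec hs.1 hs.2.1 i

/-- **Proposition 2** (uniqueness of the positive solution of the Case I equality
system): there is at most one pair `(β, λ)` with all entries positive satisfying
both families of equalities. -/
theorem caseI_equality_system_unique
    (M K : ℕ) (h : Fin M → Fin K → ℂ) (σ2 : ℝ) (hσ : 0 < σ2)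
    (u : Fin K → Fin M → ℂ)
    (R : Fin K → ℝ) (hR : ∀ k, 0 < R k)
    (hch : ∀ k, dotH (u k) (hvec h k) ≠ 0)
    (C : Fin M → ℝ) (hC : ∀ m, 0 < C m)
    (β β' : Fin K → ℝ) (lam lam' : Fin M → ℝ)
    (h1 : EqSystem h σ2 u R C β lam)
    (h2 : EqSystem h σ2 u R C β' lam') :
    β = β' ∧ lam = lam' := by
  have heq : Sum.elim β lam = Sum.elim β' lam' :=
    eq_of_sum_add_eq_mul (stackedCoeff_nonneg h u) (fun _ => hσ) h1.elim_pos h2.elim_pos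
      h1.stacked h2.stacked
  exact ⟨funext fun k => congrFun heq (.inl k), funext fun m => congrFun heq (.inr m)⟩

end Stmt6
end
end

section
/- Tightness at the optimum of the scalar dual problem for Wyner-Ziv compression (Proposition, Section VI, 'proposition5'): Consider the problem: maximize σ² Σ_{k=1}^K β_k over β ∈ ℝ_{≥0}^K and λ ∈ ℝ_{≥0}^M subject to, for every k, σ² + Σ_{j≠k} β_j|ū_k^H h_j|² + Σ_{m=1}^M λ_m|ū_{k,m}|² − β_k|ū_k^H h_k|²/(2^{R_k}−1) ≥ 0, and for every m, 2^{C_m} λ_m ≤ Ω^{(m,m)} − Ω^{(m,1:m−1)}(Ω^{(1:m−1,1:m−1)})^{−1}Ω^{(1:m−1,m)}, where Ω = σ²I + Σ_k β_k h_k h_k^H + diag(λ). Assume Σ_{k=1}^K |ū_{k,m}|² > 0 and C_m > 0 for every m, and R_k > 0, ū_k^H h_k ≠ 0 for every k. Then every optimal solution satisfies all of these constraints with equality: σ² + Σ_{j≠k} β_j|ū_k^H h_j|² + Σ_m λ_m|ū_{k,m}|² = β_k|ū_k^H h_k|²/(2^{R_k}−1) for all k, and 2^{C_m} λ_m = Ω^{(m,m)}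 − Ω^{(m,1:m−1)}(Ω^{(1:m−1,1:m−1)})^{−1}Ω^{(1:m−1,m)} for all m. -/
open Finset Matrix

noncomputable section

namespace Stmt11

/-- Hermitian inner product `x^H y`. -/
def dotH {M : ℕ} (x y : Fin M → ℂ) : ℂ := ∑ m, (starRingEnd ℂ) (x m) * y m

/-- channel vector of user `k` (column of the `M × K` uplink channel matrix). -/
def hvec {M K : ℕ} (h : Fin M → Fin K → ℂ) (k : Fin K) : Fin M → ℂ := fun m => h m k

/-- `X^{(m,1:m-1)} (X^{(1:m-1,1:m-1)})⁻¹ X^{(1:m-1,m)}` (equal to `0` for the first index). -/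
def leadProd {n : ℕ} (X : Matrix (Fin n) (Fin n) ℂ) (m : Fin n) : ℂ :=
  ∑ i : Fin m.val, ∑ j : Fin m.val,
    X m (Fin.castLE m.isLt.le i) *
      (X.submatrix (Fin.castLE m.isLt.le) (Fin.castLE m.isLt.le))⁻¹ i j *
      X (Fin.castLE m.isLt.le j) m

/-- leading Schur complement. -/
def schurLead {n : ℕ} (X : Matrix (Fin n) (Fin n) ℂ) (m : Fin n) : ℂ :=
  X m m - leadProd X m

/-- `Ω = σ²I + Σ_k β_k h_k h_k^H + diag(λ)`. -/
def Omega {M K : ℕ} (h : Fin M → Fin K → ℂ) (σ2 : ℝ) (β : Fin K → ℝ)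
    (lam : Fin M → ℝ) : Matrix (Fin M) (Fin M) ℂ :=
  fun i j => (∑ k, (β k : ℂ) * h i k * (starRingEnd ℂ) (h j k)) +
    (if i = j then ((σ2 + lam i : ℝ) : ℂ) else 0)

/-- Feasibility for the scalar dual problem with Wyner-Ziv fronthaul constraints. -/
def ScalarFeas {M K : ℕ} (h : Fin M → Fin K → ℂ) (σ2 : ℝ)
    (u : Fin K → Fin M → ℂ) (R : Fin K → ℝ) (C : Fin M → ℝ)
    (β : Fin K → ℝ) (lam : Fin M → ℝ) : Prop :=
  (∀ k, 0 ≤ β k) ∧ (∀ m, 0 ≤ lam m) ∧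
  (∀ k, 0 ≤ σ2 + ∑ j ∈ Finset.univ.erase k, β j * Complex.normSq (dotH (u k) (hvec h j)) +
      ∑ m, lam m * Complex.normSq (u k m) -
      β k * Complex.normSq (dotH (u k) (hvec h k)) / ((2:ℝ) ^ (R k) - 1)) ∧
  (∀ m, (2:ℝ) ^ (C m) * lam m ≤ (schurLead (Omega h σ2 β lam) m).re)

open scoped ComplexOrder

/-- The leading block of `X` bordered by row and column `m`, with `t` subtracted from the corner. -/
def borderedBlock {n : ℕ} (X : Matrix (Fin n) (Fin n) ℂ) (m : Fin n) (t : ℂ) :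
    Matrix (Fin m.val ⊕ Unit) (Fin m.val ⊕ Unit) ℂ :=
  fromBlocks (X.submatrix (Fin.castLE m.isLt.le) (Fin.castLE m.isLt.le))
    (of fun i _ => X (Fin.castLE m.isLt.le i) m)
    (of fun i _ => X (Fin.castLE m.isLt.le i) m)ᴴ (of fun _ _ => X m m - t)

lemma posSemidef_borderedBlock_iff {n : ℕ} {X : Matrix (Fin n) (Fin n) ℂ} (hX : X.PosDef)
    (m : Fin n) (t : ℂ) : (borderedBlock X m t).PosSemidef ↔ t ≤ schurLead X m := by
  have hA : (X.submatrix (Fin.castLE m.isLt.le) (Fin.castLE m.isLt.le)).PosDef :=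
    hX.submatrix (Fin.castLE_injective _)
  have : Invertible (X.submatrix (Fin.castLE m.isLt.le) (Fin.castLE m.isLt.le)) :=
    hA.isUnit.invertible
  have hherm : ∀ i, star (X (Fin.castLE m.isLt.le i) m) = X m (Fin.castLE m.isLt.le i) :=
    fun i => hX.isHermitian.apply _ _
  rw [borderedBlock, PosDef.fromBlocks₁₁ _ _ hA, ← sub_nonneg]
  have hscalar : (of fun _ _ => X m m - t : Matrix Unit Unit ℂ) -
      (of fun (i : Fin m.val) (_ : Unit) => X (Fin.castLE m.isLt.le i) m)ᴴ *
        (X.submatrix (Fin.castLE m.isLt.le) (Fin.castLE m.isLt.le))⁻¹ *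
        (of fun (i : Fin m.val) (_ : Unit) => X (Fin.castLE m.isLt.le i) m) =
      diagonal fun _ => schurLead X m - t := by
    ext
    simp only [Matrix.sub_apply, of_apply, mul_apply, conjTranspose_apply, hherm, sum_mul,
      diagonal_apply, schurLead, leadProd]
    rw [sum_comm]
    simp
    ring
  rw [hscalar, posSemidef_diagonal_iff]
  simp

/-- Leading Schur complements are monotone for the Loewner order. -/
lemma schurLead_mono {n : ℕ} {X Y : Matrix (Fin n) (Fin n) ℂ} (hX : X.PosDef)
    (hXY : (Y - X).PosSemidef) (m : Fin n) : schurLead X m ≤ schurLead Y m := by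
  have hY : Y.PosDef := by simpa using hX.add_posSemidef hXY
  have hblock : borderedBlock Y m (schurLead X m) = borderedBlock X m (schurLead X m) +
      (Y - X).submatrix (Sum.elim (Fin.castLE m.isLt.le) fun _ => m)
        (Sum.elim (Fin.castLE m.isLt.le) fun _ => m) := by
    have hherm {Z : Matrix (Fin n) (Fin n) ℂ} (hZ : Z.PosDef) (i j) :
        (starRingEnd ℂ) (Z i j) = Z j i := hZ.isHermitian.apply _ _
    ext (i | i) (j | j) <;> simp [borderedBlock, hherm hX, hherm hY]
  rw [← posSemidef_borderedBlock_iff hY, hblock]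
  exact ((posSemidef_borderedBlock_iff hX m _).2 le_rfl).add (hXY.submatrix _)

section Omega

variable {M K : ℕ} (h : Fin M → Fin K → ℂ)

lemma Omega_eq (σ2 : ℝ) (β : Fin K → ℝ) (lam : Fin M → ℝ) :
    Omega h σ2 β lam = ∑ k, (β k : ℂ) • vecMulVec (hvec h k) (star (hvec h k)) +
      diagonal fun i => ((σ2 + lam i : ℝ) : ℂ) := by
  ext i j
  simp [Omega, Matrix.sum_apply, vecMulVec_apply, hvec, diagonal_apply, mul_assoc]

lemma Omega_sub (σ2 : ℝ) (β β' : Fin K → ℝ) (lam lam' : Fin M → ℝ) :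
    Omega h σ2 β' lam' - Omega h σ2 β lam = Omega h 0 (β' - β) (lam' - lam) := by
  ext i j
  simp only [Omega, Matrix.sub_apply, Pi.sub_apply, Complex.ofReal_sub, sub_mul, sum_sub_distrib]
  split_ifs <;> push_cast <;> ring

variable {β : Fin K → ℝ} {lam : Fin M → ℝ}

lemma posSemidef_sum_vecMulVec (hβ : 0 ≤ β) :
    (∑ k, (β k : ℂ) • vecMulVec (hvec h k) (star (hvec h k))).PosSemidef :=
  posSemidef_sum _ fun k _ =>
    (posSemidef_vecMulVec_self_star _).smul (Complex.zero_le_real.2 (hβ k))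

lemma Omega_posSemidef {σ2 : ℝ} (hσ : 0 ≤ σ2) (hβ : 0 ≤ β) (hlam : 0 ≤ lam) :
    (Omega h σ2 β lam).PosSemidef := by
  rw [Omega_eq]
  exact (posSemidef_sum_vecMulVec h hβ).add
    (.diagonal fun i => Complex.zero_le_real.2 (add_nonneg hσ (hlam i)))

lemma Omega_posDef {σ2 : ℝ} (hσ : 0 < σ2) (hβ : 0 ≤ β) (hlam : 0 ≤ lam) :
    (Omega h σ2 β lam).PosDef := by
  rw [Omega_eq]
  exact .posSemidef_add (posSemidef_sum_vecMulVec h hβ)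
    (.diagonal fun i => Complex.zero_lt_real.2 (add_pos_of_pos_of_nonneg hσ (hlam i)))

lemma re_schurLead_Omega_mono {σ2 : ℝ} (hσ : 0 < σ2) (hβ : 0 ≤ β) (hlam : 0 ≤ lam)
    {β' : Fin K → ℝ} {lam' : Fin M → ℝ} (hββ' : β ≤ β') (hll' : lam ≤ lam') (m : Fin M) :
    (schurLead (Omega h σ2 β lam) m).re ≤ (schurLead (Omega h σ2 β' lam') m).re := by
  refine (Complex.le_def.1 (schurLead_mono (Omega_posDef h hσ hβ hlam) ?_ m)).1
  rw [Omega_sub]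
  exact Omega_posSemidef h le_rfl (sub_nonneg.2 hββ') (sub_nonneg.2 hll')

end Omega

/-- At an optimal solution every user-rate constraint is tight: otherwise the corresponding
`β k` could be increased. -/
lemma rate_eq_of_optimal {M K : ℕ} {h : Fin M → Fin K → ℂ} {σ2 : ℝ} (hσ : 0 < σ2)
    {u : Fin K → Fin M → ℂ} {R : Fin K → ℝ} (hR : ∀ k, 0 < R k)
    (hch : ∀ k, dotH (u k) (hvec h k) ≠ 0) {C : Fin M → ℝ} {β : Fin K → ℝ} {lam : Fin M → ℝ}
    (hfeas : ScalarFeas h σ2 u R C β lam)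
    (hopt : ∀ (β' : Fin K → ℝ) (lam' : Fin M → ℝ), ScalarFeas h σ2 u R C β' lam' →
      σ2 * ∑ k, β' k ≤ σ2 * ∑ k, β k) (k : Fin K) :
    σ2 + ∑ j ∈ Finset.univ.erase k, β j * Complex.normSq (dotH (u k) (hvec h j)) +
      ∑ m, lam m * Complex.normSq (u k m) =
      β k * Complex.normSq (dotH (u k) (hvec h k)) / ((2:ℝ) ^ (R k) - 1) := by
  obtain ⟨hβ, hlam, hrate, hfront⟩ := hfeas
  by_contra hne
  have hslack := lt_of_le_of_ne (hrate k) (Ne.symm (sub_ne_zero.2 hne))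
  set s := σ2 + ∑ j ∈ Finset.univ.erase k, β j * Complex.normSq (dotH (u k) (hvec h j)) +
    ∑ m, lam m * Complex.normSq (u k m) -
    β k * Complex.normSq (dotH (u k) (hvec h k)) / ((2:ℝ) ^ (R k) - 1) with hs
  have hN : 0 < Complex.normSq (dotH (u k) (hvec h k)) := Complex.normSq_pos.2 (hch k)
  have hden : 0 < (2:ℝ) ^ (R k) - 1 :=
    sub_pos.2 (Real.one_lt_rpow one_lt_two (hR k))
  obtain ⟨ε, hε, hεs⟩ : ∃ ε > 0,
      ε * Complex.normSq (dotH (u k) (hvec h k)) / ((2:ℝ) ^ (R k) - 1) = s :=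
    ⟨s * ((2:ℝ) ^ (R k) - 1) / Complex.normSq (dotH (u k) (hvec h k)), by positivity,
      by field_simp⟩
  have hle : β ≤ β + Pi.single k ε := le_add_of_nonneg_right (Pi.single_nonneg.2 hε.le)
  have hnew : ScalarFeas h σ2 u R C (β + Pi.single k ε) lam := by
    refine ⟨fun j => (hβ j).trans (hle j), hlam, fun j => ?_, fun m =>
      (hfront m).trans (re_schurLead_Omega_mono h hσ hβ hlam hle le_rfl m)⟩
    have hsum : ∑ i ∈ Finset.univ.erase j, β i * Complex.normSq (dotH (u j) (hvec h i)) ≤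
        ∑ i ∈ Finset.univ.erase j, (β + Pi.single k ε : Fin K → ℝ) i *
          Complex.normSq (dotH (u j) (hvec h i)) :=
      sum_le_sum fun i _ => mul_le_mul_of_nonneg_right (hle i) (Complex.normSq_nonneg _)
    rcases eq_or_ne j k with rfl | hjk
    · have hdiv : (β + Pi.single j ε : Fin K → ℝ) j * Complex.normSq (dotH (u j) (hvec h j)) /
          ((2:ℝ) ^ (R j) - 1) =
          β j * Complex.normSq (dotH (u j) (hvec h j)) / ((2:ℝ) ^ (R j) - 1) + s := by
        rw [← hεs, Pi.add_apply, Pi.single_eq_same, add_mul, add_div]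
      linarith
    · have hj := hrate j
      have hval : (β + Pi.single k ε : Fin K → ℝ) j = β j := by simp [hjk]
      rw [hval]
      linarith
  have hobj := le_of_mul_le_mul_left (hopt _ _ hnew) hσ
  simp only [Pi.add_apply, sum_add_distrib, sum_pi_single', mem_univ, if_true] at hobj
  linarith

/-- **Tightness at the optimum of the scalar dual problem for Wyner-Ziv compression**:
at any optimal solution, all user-rate constraints and all fronthaul constraints hold
with equality. -/
theorem scalar_dual_tightness
    (M K : ℕ) (h : Fin M → Fin K → ℂ) (σ2 : ℝ) (hσ : 0 < σ2)
    (u : Fin K → Fin M → ℂ) (hcov : ∀ m, 0 < ∑ k, Complex.normSq (u k m))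
    (R : Fin K → ℝ) (hR : ∀ k, 0 < R k)
    (hch : ∀ k, dotH (u k) (hvec h k) ≠ 0)
    (C : Fin M → ℝ) (hC : ∀ m, 0 < C m)
    (β : Fin K → ℝ) (lam : Fin M → ℝ)
    (hfeas : ScalarFeas h σ2 u R C β lam)
    (hopt : ∀ (β' : Fin K → ℝ) (lam' : Fin M → ℝ), ScalarFeas h σ2 u R C β' lam' →
      σ2 * ∑ k, β' k ≤ σ2 * ∑ k, β k) :
    (∀ k, σ2 + ∑ j ∈ Finset.univ.erase k, β j * Complex.normSq (dotH (u k) (hvec h j)) +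
        ∑ m, lam m * Complex.normSq (u k m) =
        β k * Complex.normSq (dotH (u k) (hvec h k)) / ((2:ℝ) ^ (R k) - 1)) ∧
    (∀ m, (2:ℝ) ^ (C m) * lam m = (schurLead (Omega h σ2 β lam) m).re) := by
  refine ⟨rate_eq_of_optimal hσ hR hch hfeas hopt, fun m => ?_⟩
  have ⟨hβ, hlam, hrate, hfront⟩ := hfeas
  by_contra hne
  have hlt := lt_of_le_of_ne (hfront m) hne
  have hpow : 0 < (2:ℝ) ^ (C m) := by positivity
  obtain ⟨ε, hε, hεs⟩ : ∃ ε > 0, (2:ℝ) ^ (C m) * (lam m + ε) =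
      (schurLead (Omega h σ2 β lam) m).re :=
    ⟨(schurLead (Omega h σ2 β lam) m).re / (2:ℝ) ^ (C m) - lam m,
      sub_pos.2 ((lt_div_iff₀' hpow).2 hlt), by field_simp; ring⟩
  have hle : lam ≤ lam + Pi.single m ε := le_add_of_nonneg_right (Pi.single_nonneg.2 hε.le)
  have hsum (k : Fin K) : ∑ i, (lam + Pi.single m ε : Fin M → ℝ) i * Complex.normSq (u k i) =
      ∑ i, lam i * Complex.normSq (u k i) + ε * Complex.normSq (u k m) := by
    simp [add_mul, sum_add_distrib, Pi.single_apply]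
  have hnew : ScalarFeas h σ2 u R C β (lam + Pi.single m ε) := by
    refine ⟨hβ, fun i => (hlam i).trans (hle i), fun k => ?_, fun i => ?_⟩
    · rw [hsum]
      linarith [hrate k, mul_nonneg hε.le (Complex.normSq_nonneg (u k m))]
    · refine le_trans ?_ (re_schurLead_Omega_mono h hσ hβ hlam le_rfl hle i)
      rcases eq_or_ne i m with rfl | him
      · simp [hεs]
      · simpa [him] using hfront i
  obtain ⟨k, -, hk⟩ := exists_lt_of_sum_lt (s := univ) (f := fun _ : Fin K => (0 : ℝ))
    (by simpa using hcov m)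
  have hold := rate_eq_of_optimal hσ hR hch hfeas hopt k
  have htight := rate_eq_of_optimal hσ hR hch hnew hopt k
  rw [hsum] at htight
  linarith [mul_pos hε hk]

end Stmt11
end
end

section
/- Uniqueness of the solution of the nonlinear equality system for Wyner-Ziv compression (Proposition, Section VI, 'proposition6'): Assume C_m > 0 for every m and R_k > 0, ū_k^H h_k ≠ 0 for every k. Then there is at most one pair (β,λ) with β ∈ ℝ^K, β_k > 0 for all k, and λ ∈ ℝ^M, λ_m > 0 for all m, satisfying simultaneously: for every k, σ² + Σ_{j≠k} β_j|ū_k^H h_j|² + Σ_{m=1}^M λ_m|ū_{k,m}|² = β_k|ū_k^H h_k|²/(2^{R_k}−1), and for every m, 2^{C_m} λ_m = Ω^{(m,m)} − Ω^{(m,1:m−1)}(Ω^{(1:m−1,1:m−1)})^{−1}Ω^{(1:m−1,m)}, where Ω = σ²I + Σ_{k=1}^K β_k h_k h_k^H + diag(λ_1,…,λ_M) and the subtracted term is 0 when m = 1. -/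
open Finset Matrix

noncomputable section

namespace Stmt12

/-- Hermitian inner product `x^H y`. -/
def dotH {M : ℕ} (x y : Fin M → ℂ) : ℂ := ∑ m, (starRingEnd ℂ) (x m) * y m

/-- channel vector of user `k` (column of the `M × K` uplink channel matrix). -/
def hvec {M K : ℕ} (h : Fin M → Fin K → ℂ) (k : Fin K) : Fin M → ℂ := fun m => h m k

/-- `X^{(m,1:m-1)} (X^{(1:m-1,1:m-1)})⁻¹ X^{(1:m-1,m)}` (equal to `0` for the first index). -/
def leadProd {n : ℕ} (X : Matrix (Fin n) (Fin n) ℂ) (m : Fin n) : ℂ :=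
  ∑ i : Fin m.val, ∑ j : Fin m.val,
    X m (Fin.castLE m.isLt.le i) *
      (X.submatrix (Fin.castLE m.isLt.le) (Fin.castLE m.isLt.le))⁻¹ i j *
      X (Fin.castLE m.isLt.le j) m

/-- leading Schur complement. -/
def schurLead {n : ℕ} (X : Matrix (Fin n) (Fin n) ℂ) (m : Fin n) : ℂ :=
  X m m - leadProd X m

/-- `Ω = σ²I + Σ_k β_k h_k h_k^H + diag(λ)`. -/
def Omega {M K : ℕ} (h : Fin M → Fin K → ℂ) (σ2 : ℝ) (β : Fin K → ℝ)
    (lam : Fin M → ℝ) : Matrix (Fin M) (Fin M) ℂ :=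
  fun i j => (∑ k, (β k : ℂ) * h i k * (starRingEnd ℂ) (h j k)) +
    (if i = j then ((σ2 + lam i : ℝ) : ℂ) else 0)

/-- The nonlinear equality system for Wyner-Ziv compression with positive variables. -/
def EqSystemWZ {M K : ℕ} (h : Fin M → Fin K → ℂ) (σ2 : ℝ)
    (u : Fin K → Fin M → ℂ) (R : Fin K → ℝ) (C : Fin M → ℝ)
    (β : Fin K → ℝ) (lam : Fin M → ℝ) : Prop :=
  (∀ k, 0 < β k) ∧ (∀ m, 0 < lam m) ∧
  (∀ k, σ2 + ∑ j ∈ Finset.univ.erase k, β j * Complex.normSq (dotH (u k) (hvec h j)) +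
      ∑ m, lam m * Complex.normSq (u k m) =
      β k * Complex.normSq (dotH (u k) (hvec h k)) / ((2:ℝ) ^ (R k) - 1)) ∧
  (∀ m, (2:ℝ) ^ (C m) * lam m = (schurLead (Omega h σ2 β lam) m).re)

section

open scoped ComplexOrder

/-- A scaling argument: if every dilation of `x` by a factor `α > 1` which dominates `y`
dominates it strictly, then `y ≤ x`. -/
lemma le_of_forall_scale_lt {ι : Type*} [Finite ι] {x y : ι → ℝ} (hx : ∀ i, 0 < x i)
    (hxy : ∀ α : ℝ, 1 < α → (∀ i, y i ≤ α * x i) → ∀ i, y i < α * x i) : y ≤ x := by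
  intro i
  by_contra! hi
  have : Nonempty ι := ⟨i⟩
  obtain ⟨j, hj⟩ := Finite.exists_max (fun i => y i / x i)
  have hα : 1 < y j / x j := ((one_lt_div (hx i)).2 hi).trans_le (hj i)
  have hlt := hxy _ hα (fun k => (div_le_iff₀ (hx k)).1 (hj k)) j
  rw [div_mul_cancel₀ _ (hx j).ne'] at hlt
  exact lt_irrefl _ hlt

/-- The quadratic form of a Hermitian matrix at `x ⊕ 1`, supported on the first `m + 1`
coordinates, by completing the square. -/
lemma quadForm_lead_eq {n : ℕ} {X : Matrix (Fin n) (Fin n) ℂ} (hX : X.PosDef) (m : Fin n)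
    (x : Fin m.val → ℂ) :
    let f : Fin m.val ⊕ Unit → Fin n := Sum.elim (Fin.castLE m.isLt.le) (fun _ => m)
    let A := X.submatrix (Fin.castLE m.isLt.le) (Fin.castLE m.isLt.le)
    let c := x + A⁻¹ *ᵥ (fun j => X (Fin.castLE m.isLt.le j) m)
    star (Sum.elim x 1) ⬝ᵥ (X.submatrix f f *ᵥ Sum.elim x 1) =
      star c ⬝ᵥ (A *ᵥ c) + schurLead X m := by
  intro f A c
  have hA : A.PosDef := hX.submatrix (Fin.castLE_injective _)
  let : Invertible A := hA.isUnit.invertible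
  let B : Matrix (Fin m.val) Unit ℂ := of fun j _ => X (Fin.castLE m.isLt.le j) m
  let D : Matrix Unit Unit ℂ := of fun _ _ => X m m
  have hblocks : X.submatrix f f = fromBlocks A B Bᴴ D := by
    ext (i | i) (j | j)
    · rfl
    · rfl
    · exact (hX.isHermitian.apply _ _).symm
    · rfl
  have hB : ∀ j, X m (Fin.castLE m.isLt.le j) = star (B j ()) := fun j =>
    (hX.isHermitian.apply _ _).symm
  have hc : x + (A⁻¹ * B) *ᵥ (1 : Unit → ℂ) = c := by
    rw [← mulVec_mulVec]
    congr 2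
    ext i
    simp [mulVec, dotProduct, B]
  have hS : star (1 : Unit → ℂ) ⬝ᵥ ((D - Bᴴ * A⁻¹ * B) *ᵥ (1 : Unit → ℂ)) =
      schurLead X m := by
    have hval : star (1 : Unit → ℂ) ⬝ᵥ ((D - Bᴴ * A⁻¹ * B) *ᵥ (1 : Unit → ℂ)) =
        D () () - (Bᴴ * A⁻¹ * B) () () := by
      simp [mulVec, dotProduct]
    rw [hval, Matrix.mul_apply]
    simp only [Matrix.mul_apply, Matrix.conjTranspose_apply, Finset.sum_mul, schurLead,
      leadProd, hB]
    rw [Finset.sum_comm]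
    rfl
  have key := schur_complement_eq₁₁ B D x (1 : Unit → ℂ) hA.isHermitian
  rw [hc] at key
  rw [hblocks, ← hS]
  simpa only [dotProduct_mulVec] using key

/-- Strict monotonicity, up to scaling, of the leading Schur complement in the Loewner order. -/
lemma schurLead_re_lt {n : ℕ} {X Y : Matrix (Fin n) (Fin n) ℂ} (hX : X.PosDef)
    (hY : Y.PosDef) {α : ℝ} (hXY : ((α : ℂ) • Y - X).PosDef) (m : Fin n) :
    (schurLead X m).re < α * (schurLead Y m).re := by
  set f : Fin m.val ⊕ Unit → Fin n := Sum.elim (Fin.castLE m.isLt.le) (fun _ => m) with hf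
  have hfi : Function.Injective f := by
    rw [hf, Sum.elim_injective]
    refine ⟨Fin.castLE_injective _, Function.injective_of_subsingleton _, fun a _ hab => ?_⟩
    have := congrArg Fin.val hab
    have := a.isLt
    simp at *
    omega
  set x : Fin m.val → ℂ := -((Y.submatrix (Fin.castLE m.isLt.le) (Fin.castLE m.isLt.le))⁻¹ *ᵥ
    (fun j => Y (Fin.castLE m.isLt.le j) m)) with hx
  set w : Fin m.val ⊕ Unit → ℂ := Sum.elim x 1
  have hw : w ≠ 0 := fun h0 => by simpa [w] using congrFun h0 (Sum.inr ())
  have hYw : star w ⬝ᵥ (Y.submatrix f f *ᵥ w) = schurLead Y m := by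
    have := quadForm_lead_eq hY m x
    simpa [hx] using this
  have hXw : (schurLead X m).re ≤ (star w ⬝ᵥ (X.submatrix f f *ᵥ w)).re := by
    have := quadForm_lead_eq hX m x
    simp only at this
    rw [this, Complex.add_re]
    exact le_add_of_nonneg_left
      ((hX.submatrix (Fin.castLE_injective m.isLt.le)).posSemidef.re_dotProduct_nonneg _)
  have hpos := (hXY.submatrix hfi).re_dotProduct_pos hw
  have hsplit : ((α : ℂ) • Y - X).submatrix f f = (α : ℂ) • Y.submatrix f f - X.submatrix f f :=
    rfl
  rw [hsplit, sub_mulVec, smul_mulVec, dotProduct_sub, dotProduct_smul, hYw] at hpos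
  simp at hpos
  linarith

/-- A nonnegative combination of the `h_k h_kᴴ` plus a positive diagonal is positive definite. -/
lemma posDef_sum_add_diagonal {M K : ℕ} (h : Fin M → Fin K → ℂ) {b : Fin K → ℝ}
    {d : Fin M → ℝ} (hb : ∀ k, 0 ≤ b k) (hd : ∀ m, 0 < d m) :
    (∑ k, (b k : ℂ) • vecMulVec (hvec h k) (star (hvec h k)) +
      diagonal (fun m => (d m : ℂ))).PosDef := by
  refine PosDef.posSemidef_add (posSemidef_sum _ fun k _ => ?_)
    (PosDef.diagonal fun m => by exact_mod_cast hd m)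
  exact (posSemidef_vecMulVec_self_star _).smul (by exact_mod_cast hb k)

lemma Omega_eq {M K : ℕ} (h : Fin M → Fin K → ℂ) (σ2 : ℝ) (β : Fin K → ℝ) (lam : Fin M → ℝ) :
    Omega h σ2 β lam = ∑ k, (β k : ℂ) • vecMulVec (hvec h k) (star (hvec h k)) +
      diagonal (fun m => ((σ2 + lam m : ℝ) : ℂ)) := by
  ext i j
  simp [Omega, Matrix.sum_apply, vecMulVec_apply, hvec, diagonal_apply, mul_assoc]

lemma smul_Omega_sub_Omega {M K : ℕ} (h : Fin M → Fin K → ℂ) (σ2 α : ℝ) (β β' : Fin K → ℝ)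
    (lam lam' : Fin M → ℝ) :
    (α : ℂ) • Omega h σ2 β lam - Omega h σ2 β' lam' =
      ∑ k, ((α * β k - β' k : ℝ) : ℂ) • vecMulVec (hvec h k) (star (hvec h k)) +
      diagonal (fun m => (((α - 1) * σ2 + (α * lam m - lam' m) : ℝ) : ℂ)) := by
  simp only [Omega_eq, Complex.ofReal_sub, Complex.ofReal_mul, sub_smul, mul_smul,
    Finset.sum_sub_distrib, smul_add, Finset.smul_sum]
  have hdiag : diagonal (fun m => (((α - 1) * σ2 + (α * lam m - lam' m) : ℝ) : ℂ)) =
      (α : ℂ) • diagonal (fun m => ((σ2 + lam m : ℝ) : ℂ)) -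
        diagonal (fun m => ((σ2 + lam' m : ℝ) : ℂ)) := by
    rw [← diagonal_smul, diagonal_sub]
    congr 1
    ext m
    simp
    ring
  simp only [Complex.ofReal_add, Complex.ofReal_sub, Complex.ofReal_mul] at hdiag ⊢
  rw [hdiag]
  abel

/-- Any solution of the system is dominated componentwise by any other solution. -/
lemma EqSystemWZ.le {M K : ℕ} {h : Fin M → Fin K → ℂ} {σ2 : ℝ} (hσ : 0 < σ2)
    {u : Fin K → Fin M → ℂ} {R : Fin K → ℝ} (hR : ∀ k, 0 < R k)
    (hch : ∀ k, dotH (u k) (hvec h k) ≠ 0) {C : Fin M → ℝ}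
    {β β' : Fin K → ℝ} {lam lam' : Fin M → ℝ}
    (h1 : EqSystemWZ h σ2 u R C β lam) (h2 : EqSystemWZ h σ2 u R C β' lam') :
    β' ≤ β ∧ lam' ≤ lam := by
  obtain ⟨hβ, hlam, hrate, hcap⟩ := h1
  obtain ⟨hβ', hlam', hrate', hcap'⟩ := h2
  have hle : Sum.elim β' lam' ≤ Sum.elim β lam := by
    refine le_of_forall_scale_lt (by rintro (k | m) <;> simp [hβ, hlam]) fun α hα hdom => ?_
    have hdβ : ∀ k, β' k ≤ α * β k := fun k => hdom (Sum.inl k)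
    have hdl : ∀ m, lam' m ≤ α * lam m := fun m => hdom (Sum.inr m)
    have hασ : 0 < (α - 1) * σ2 := mul_pos (sub_pos.2 hα) hσ
    rintro (k | m)
    · simp only [Sum.elim_inl]
      have hden : 0 < (2 : ℝ) ^ R k - 1 := sub_pos.2 (Real.one_lt_rpow one_lt_two (hR k))
      have hc : 0 < Complex.normSq (dotH (u k) (hvec h k)) / ((2 : ℝ) ^ R k - 1) :=
        div_pos (Complex.normSq_pos.2 (hch k)) hden
      have hsβ : ∑ j ∈ Finset.univ.erase k, β' j * Complex.normSq (dotH (u k) (hvec h j)) ≤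
          α * ∑ j ∈ Finset.univ.erase k, β j * Complex.normSq (dotH (u k) (hvec h j)) := by
        rw [Finset.mul_sum]
        refine Finset.sum_le_sum fun j _ => ?_
        rw [← mul_assoc]
        exact mul_le_mul_of_nonneg_right (hdβ j) (Complex.normSq_nonneg _)
      have hsl : ∑ m, lam' m * Complex.normSq (u k m) ≤
          α * ∑ m, lam m * Complex.normSq (u k m) := by
        rw [Finset.mul_sum]
        refine Finset.sum_le_sum fun j _ => ?_
        rw [← mul_assoc]
        exact mul_le_mul_of_nonneg_right (hdl j) (Complex.normSq_nonneg _)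
      have e := hrate k
      have e' := hrate' k
      rw [mul_div_assoc] at e e'
      refine lt_of_mul_lt_mul_right ?_ hc.le
      rw [mul_assoc, ← e, ← e']
      linarith
    · simp only [Sum.elim_inr]
      have hX : (Omega h σ2 β' lam').PosDef := by
        rw [Omega_eq]
        exact posDef_sum_add_diagonal h (fun k => (hβ' k).le) fun m => add_pos hσ (hlam' m)
      have hY : (Omega h σ2 β lam).PosDef := by
        rw [Omega_eq]
        exact posDef_sum_add_diagonal h (fun k => (hβ k).le) fun m => add_pos hσ (hlam m)
      have hXY : ((α : ℂ) • Omega h σ2 β lam - Omega h σ2 β' lam').PosDef := by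
        rw [smul_Omega_sub_Omega]
        exact posDef_sum_add_diagonal h (fun k => sub_nonneg.2 (hdβ k))
          fun m => add_pos_of_pos_of_nonneg hασ (sub_nonneg.2 (hdl m))
      have hlt := schurLead_re_lt hX hY hXY m
      rw [← hcap, ← hcap', mul_left_comm] at hlt
      exact lt_of_mul_lt_mul_left hlt (by positivity)
  exact ⟨fun k => hle (Sum.inl k), fun m => hle (Sum.inr m)⟩

end

/-- **Uniqueness of the solution of the nonlinear equality system for Wyner-Ziv
compression**: there is at most one pair `(β, λ)` with all entries positive satisfying
both families of equalities. -/
theorem WZ_equality_system_unique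
    (M K : ℕ) (h : Fin M → Fin K → ℂ) (σ2 : ℝ) (hσ : 0 < σ2)
    (u : Fin K → Fin M → ℂ)
    (R : Fin K → ℝ) (hR : ∀ k, 0 < R k)
    (hch : ∀ k, dotH (u k) (hvec h k) ≠ 0)
    (C : Fin M → ℝ) (hC : ∀ m, 0 < C m)
    (β β' : Fin K → ℝ) (lam lam' : Fin M → ℝ)
    (h1 : EqSystemWZ h σ2 u R C β lam)
    (h2 : EqSystemWZ h σ2 u R C β' lam') :
    β = β' ∧ lam = lam' := by
  obtain ⟨hβ, hlam⟩ := h1.le hσ hR hch h2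
  obtain ⟨hβ', hlam'⟩ := h2.le hσ hR hch h1
  exact ⟨le_antisymm hβ' hβ, le_antisymm hlam' hlam⟩

end Stmt12
end
end

section
/- Equivalence of the equality-constrained and inequality-constrained uplink power-minimization problems (Proposition, Section VI, 'proposition7'): Assume C_m > 0 for every m, R_k > 0 and ū_k^H h_k ≠ 0 for every k, and Σ_{k=1}^K |ū_{k,m}|² > 0 for every m. Then the infimum of σ² Σ_{k=1}^K β_k over pairs (β,λ) with β_k > 0, λ_m > 0 satisfying the equality system — σ² + Σ_{j≠k} β_j|ū_k^H h_j|² + Σ_m λ_m|ū_{k,m}|² = β_k|ū_k^H h_k|²/(2^{R_k}−1) for all k, and 2^{C_m}λ_m = Ω^{(m,m)} − Ω^{(m,1:m−1)}(Ω^{(1:m−1,1:m−1)})^{−1}Ω^{(1:m−1,m)} for all m — equals the infimum of σ² Σ_k β_k over pairs (β,λ) with β_k > 0, λ_m > 0 satisfying the inequalities σ² + Σ_{j≠k} β_j|ū_k^H h_j|² + Σ_m λ_m|ū_{k,m}|² − β_k|ū_k^H h_k|²/(2^{R_k}−1) ≤ 0 for all k and 2^{C_m}λ_m ≥ Ω^{(m,m)}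 − Ω^{(m,1:m−1)}(Ω^{(1:m−1,1:m−1)})^{−1}Ω^{(1:m−1,m)} for all m; moreover every optimal solution of the inequality-constrained problem satisfies all these constraints with equality. -/
open Finset Matrix

noncomputable section

namespace Stmt13

/-- Hermitian inner product `x^H y`. -/
def dotH {M : ℕ} (x y : Fin M → ℂ) : ℂ := ∑ m, (starRingEnd ℂ) (x m) * y m

/-- channel vector of user `k` (column of the `M × K` uplink channel matrix). -/
def hvec {M K : ℕ} (h : Fin M → Fin K → ℂ) (k : Fin K) : Fin M → ℂ := fun m => h m k

/-- `X^{(m,1:m-1)} (X^{(1:m-1,1:m-1)})⁻¹ X^{(1:m-1,m)}` (equal to `0` for the first index). -/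
def leadProd {n : ℕ} (X : Matrix (Fin n) (Fin n) ℂ) (m : Fin n) : ℂ :=
  ∑ i : Fin m.val, ∑ j : Fin m.val,
    X m (Fin.castLE m.isLt.le i) *
      (X.submatrix (Fin.castLE m.isLt.le) (Fin.castLE m.isLt.le))⁻¹ i j *
      X (Fin.castLE m.isLt.le j) m

/-- leading Schur complement. -/
def schurLead {n : ℕ} (X : Matrix (Fin n) (Fin n) ℂ) (m : Fin n) : ℂ :=
  X m m - leadProd X m

/-- `Ω = σ²I + Σ_k β_k h_k h_k^H + diag(λ)`. -/
def Omega {M K : ℕ} (h : Fin M → Fin K → ℂ) (σ2 : ℝ) (β : Fin K → ℝ)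
    (lam : Fin M → ℝ) : Matrix (Fin M) (Fin M) ℂ :=
  fun i j => (∑ k, (β k : ℂ) * h i k * (starRingEnd ℂ) (h j k)) +
    (if i = j then ((σ2 + lam i : ℝ) : ℂ) else 0)

/-- The equality-constrained uplink system (with positive variables). -/
def EqFeas {M K : ℕ} (h : Fin M → Fin K → ℂ) (σ2 : ℝ)
    (u : Fin K → Fin M → ℂ) (R : Fin K → ℝ) (C : Fin M → ℝ)
    (β : Fin K → ℝ) (lam : Fin M → ℝ) : Prop :=
  (∀ k, 0 < β k) ∧ (∀ m, 0 < lam m) ∧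
  (∀ k, σ2 + ∑ j ∈ Finset.univ.erase k, β j * Complex.normSq (dotH (u k) (hvec h j)) +
      ∑ m, lam m * Complex.normSq (u k m) =
      β k * Complex.normSq (dotH (u k) (hvec h k)) / ((2:ℝ) ^ (R k) - 1)) ∧
  (∀ m, (2:ℝ) ^ (C m) * lam m = (schurLead (Omega h σ2 β lam) m).re)

/-- The inequality-constrained uplink system (with positive variables). -/
def IneqFeas {M K : ℕ} (h : Fin M → Fin K → ℂ) (σ2 : ℝ)
    (u : Fin K → Fin M → ℂ) (R : Fin K → ℝ) (C : Fin M → ℝ)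
    (β : Fin K → ℝ) (lam : Fin M → ℝ) : Prop :=
  (∀ k, 0 < β k) ∧ (∀ m, 0 < lam m) ∧
  (∀ k, σ2 + ∑ j ∈ Finset.univ.erase k, β j * Complex.normSq (dotH (u k) (hvec h j)) +
      ∑ m, lam m * Complex.normSq (u k m) -
      β k * Complex.normSq (dotH (u k) (hvec h k)) / ((2:ℝ) ^ (R k) - 1) ≤ 0) ∧
  (∀ m, (schurLead (Omega h σ2 β lam) m).re ≤ (2:ℝ) ^ (C m) * lam m)

section LoewnerOrder

open scoped ComplexOrder

/-- Monotonicity of the leading Schur complements in the Loewner order. -/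
lemma schurLead_re_mono {n : ℕ} {X Y : Matrix (Fin n) (Fin n) ℂ} (hX : X.PosDef) (hY : Y.PosDef)
    (hXY : (Y - X).PosSemidef) (m : Fin n) : (schurLead X m).re ≤ (schurLead Y m).re := by
  let e : Fin m.val → Fin n := Fin.castLE m.isLt.le
  let f : Fin m.val ⊕ Unit → Fin n := Sum.elim e (fun _ => m)
  have he : Function.Injective e := Fin.castLE_injective m.isLt.le
  have blocks : ∀ Z : Matrix (Fin n) (Fin n) ℂ, Z.IsHermitian →
      Z.submatrix f f = fromBlocks (Z.submatrix e e) (Z.submatrix e fun _ : Unit => m)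
        (Z.submatrix e fun _ : Unit => m)ᴴ (Z.submatrix (fun _ : Unit => m) fun _ => m) := by
    intro Z hZ
    ext i j
    rcases i with i | i <;> rcases j with j | j <;> simp [f]
    exact (hZ.apply _ _).symm
  have form : ∀ Z : Matrix (Fin n) (Fin n) ℂ, Z.PosDef → ∀ x : Fin m.val → ℂ,
      star (Sum.elim x fun _ : Unit => 1) ⬝ᵥ
          (Z.submatrix f f *ᵥ Sum.elim x fun _ : Unit => 1) =
        star (x + ((Z.submatrix e e)⁻¹ * Z.submatrix e fun _ : Unit => m) *ᵥ fun _ => 1) ⬝ᵥ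
          (Z.submatrix e e *ᵥ
            (x + ((Z.submatrix e e)⁻¹ * Z.submatrix e fun _ : Unit => m) *ᵥ fun _ => 1)) +
        schurLead Z m := by
    intro Z hZ x
    have hA : (Z.submatrix e e).PosDef := hZ.submatrix he
    let _ : Invertible (Z.submatrix e e) := hA.isUnit.invertible
    rw [blocks Z hZ.isHermitian, dotProduct_mulVec, schur_complement_eq₁₁ _ _ _ _ hA.isHermitian,
      ← dotProduct_mulVec]
    congr 1
    simp only [schurLead, leadProd, dotProduct, vecMul, Matrix.sub_apply, Matrix.mul_apply,
      conjTranspose_apply, submatrix_apply, Finset.univ_unique, Finset.sum_singleton,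
      Pi.star_apply, star_one, one_mul, mul_one]
    congr 1
    rw [Finset.sum_comm]
    refine Finset.sum_congr rfl fun j _ => ?_
    rw [Finset.sum_mul]
    refine Finset.sum_congr rfl fun i _ => ?_
    rw [hZ.isHermitian.apply]
  set x : Fin m.val → ℂ :=
    -(((Y.submatrix e e)⁻¹ * Y.submatrix e fun _ : Unit => m) *ᵥ fun _ => 1)
  have hYx := form Y hY x
  rw [show x + ((Y.submatrix e e)⁻¹ * Y.submatrix e fun _ : Unit => m) *ᵥ (fun _ => 1) = 0 from
    neg_add_cancel _, mulVec_zero, dotProduct_zero, zero_add] at hYx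
  have hXx := form X hX x
  have hdiff := (hXY.submatrix f).re_dotProduct_nonneg (Sum.elim x fun _ : Unit => 1)
  have hpos := (hX.submatrix he).posSemidef.re_dotProduct_nonneg
    (x + ((X.submatrix e e)⁻¹ * X.submatrix e fun _ : Unit => m) *ᵥ fun _ => 1)
  rw [submatrix_sub, Pi.sub_apply, Pi.sub_apply, sub_mulVec, dotProduct_sub, hYx, hXx] at hdiff
  simp only [RCLike.re_to_complex, Complex.sub_re, Complex.add_re] at hdiff hpos
  linarith

lemma Omega_eq {M K : ℕ} (h : Fin M → Fin K → ℂ) (s : ℝ) (β : Fin K → ℝ) (lam : Fin M → ℝ) :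
    Omega h s β lam = ∑ k, (β k : ℂ) • vecMulVec (hvec h k) (star (hvec h k)) +
      diagonal fun i => ((s + lam i : ℝ) : ℂ) := by
  ext i j
  simp [Omega, Matrix.sum_apply, vecMulVec_apply, hvec, diagonal_apply, mul_assoc]

lemma posSemidef_sum_rankOne {M K : ℕ} (h : Fin M → Fin K → ℂ) {β : Fin K → ℝ}
    (hβ : ∀ k, 0 ≤ β k) :
    (∑ k, (β k : ℂ) • vecMulVec (hvec h k) (star (hvec h k))).PosSemidef :=
  posSemidef_sum _ fun k _ =>
    (posSemidef_vecMulVec_self_star (hvec h k)).smul (Complex.zero_le_real.2 (hβ k))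

lemma Omega_posDef {M K : ℕ} (h : Fin M → Fin K → ℂ) {s : ℝ} (hs : 0 < s) {β : Fin K → ℝ}
    {lam : Fin M → ℝ} (hβ : ∀ k, 0 ≤ β k) (hlam : ∀ m, 0 ≤ lam m) : (Omega h s β lam).PosDef := by
  rw [Omega_eq]
  refine PosDef.posSemidef_add (posSemidef_sum_rankOne h hβ) (PosDef.diagonal fun i => ?_)
  exact Complex.zero_lt_real.2 (by linarith [hlam i])

lemma Omega_sub_posSemidef {M K : ℕ} (h : Fin M → Fin K → ℂ) (s : ℝ) {β β' : Fin K → ℝ}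
    {lam lam' : Fin M → ℝ} (hβ : ∀ k, β k ≤ β' k) (hlam : ∀ m, lam m ≤ lam' m) :
    (Omega h s β' lam' - Omega h s β lam).PosSemidef := by
  have key : Omega h s β' lam' - Omega h s β lam = Omega h 0 (β' - β) (lam' - lam) := by
    ext i j
    simp only [Omega, Matrix.sub_apply, Pi.sub_apply, Complex.ofReal_sub, sub_mul,
      Finset.sum_sub_distrib]
    split_ifs
    · push_cast
      ring
    · ring
  rw [key, Omega_eq]
  refine (posSemidef_sum_rankOne h fun k => sub_nonneg.2 (hβ k)).add (PosSemidef.diagonal ?_)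
  intro i
  exact Complex.zero_le_real.2 (by simpa using hlam i)

lemma schurLead_Omega_mono {M K : ℕ} (h : Fin M → Fin K → ℂ) {s : ℝ} (hs : 0 < s)
    {β β' : Fin K → ℝ} {lam lam' : Fin M → ℝ} (hβ0 : ∀ k, 0 ≤ β k) (hlam0 : ∀ m, 0 ≤ lam m)
    (hβ : ∀ k, β k ≤ β' k) (hlam : ∀ m, lam m ≤ lam' m) (m : Fin M) :
    (schurLead (Omega h s β lam) m).re ≤ (schurLead (Omega h s β' lam') m).re :=
  schurLead_re_mono (Omega_posDef h hs hβ0 hlam0)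
    (Omega_posDef h hs (fun k => (hβ0 k).trans (hβ k)) fun m => (hlam0 m).trans (hlam m))
    (Omega_sub_posSemidef h s hβ hlam) m

lemma le_schurLead_Omega {M K : ℕ} (h : Fin M → Fin K → ℂ) {s : ℝ} (hs : 0 < s)
    {β : Fin K → ℝ} {lam : Fin M → ℝ} (hβ : ∀ k, 0 ≤ β k) (hlam : ∀ m, 0 ≤ lam m) (m : Fin M) :
    s ≤ (schurLead (Omega h s β lam) m).re := by
  have hmono := schurLead_Omega_mono h hs (β := 0) (lam := 0) (fun _ => le_rfl) (fun _ => le_rfl)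
    hβ hlam m
  have hne : ∀ i : Fin m.val, m ≠ Fin.castLE m.isLt.le i := fun i hi =>
    absurd (congrArg Fin.val hi) (by simpa using i.isLt.ne')
  have hval : schurLead (Omega h s 0 0) m = s := by
    simp [schurLead, leadProd, Omega, hne]
  rwa [hval, Complex.ofReal_re] at hmono

end LoewnerOrder

/-- A map which is monotone above `c` and takes values above `c` there has a fixed point below any
of its post-fixed points above `c`. -/
lemma exists_fixedPoint_le {ι : Type*} (T : (ι → ℝ) → ι → ℝ) (c x₀ : ι → ℝ) (hc : c ≤ x₀)
    (hT : ∀ x y, c ≤ x → x ≤ y → T x ≤ T y) (hcT : ∀ x, c ≤ x → c ≤ T x) (hx₀ : T x₀ ≤ x₀) :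
    ∃ x, c ≤ x ∧ x ≤ x₀ ∧ T x = x := by
  let S : Set (ι → ℝ) := {x | c ≤ x ∧ T x ≤ x}
  have hS : S.Nonempty := ⟨x₀, hc, hx₀⟩
  have hb : BddBelow S := ⟨c, fun x hx => hx.1⟩
  have hinf : IsGLB S (sInf S) := isGLB_csInf hS hb
  have hcs : c ≤ sInf S := hinf.2 fun x hx => hx.1
  have hle : T (sInf S) ≤ sInf S := hinf.2 fun x hx => (hT _ _ hcs (hinf.1 hx)).trans hx.2
  exact ⟨sInf S, hcs, hinf.1 ⟨hc, hx₀⟩,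
    hle.antisymm (hinf.1 ⟨hcT _ hcs, hT _ _ (hcT _ hcs) hle⟩)⟩

/-- Noise plus interference seen by user `k`. -/
def interference {M K : ℕ} (h : Fin M → Fin K → ℂ) (σ2 : ℝ) (u : Fin K → Fin M → ℂ)
    (β : Fin K → ℝ) (lam : Fin M → ℝ) (k : Fin K) : ℝ :=
  σ2 + ∑ j ∈ Finset.univ.erase k, β j * Complex.normSq (dotH (u k) (hvec h j)) +
    ∑ m, lam m * Complex.normSq (u k m)

/-- Signal gain of user `k` divided by its target signal-to-interference ratio. -/
def gain {M K : ℕ} (h : Fin M → Fin K → ℂ) (u : Fin K → Fin M → ℂ) (R : Fin K → ℝ)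
    (k : Fin K) : ℝ :=
  Complex.normSq (dotH (u k) (hvec h k)) / ((2:ℝ) ^ (R k) - 1)

lemma gain_pos {M K : ℕ} {h : Fin M → Fin K → ℂ} {u : Fin K → Fin M → ℂ} {R : Fin K → ℝ}
    (hR : ∀ k, 0 < R k) (hch : ∀ k, dotH (u k) (hvec h k) ≠ 0) (k : Fin K) : 0 < gain h u R k :=
  div_pos (Complex.normSq_pos.2 (hch k))
    (sub_pos.2 (Real.one_lt_rpow one_lt_two (hR k)))

lemma interference_mono {M K : ℕ} (h : Fin M → Fin K → ℂ) (σ2 : ℝ) (u : Fin K → Fin M → ℂ)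
    {β β' : Fin K → ℝ} {lam lam' : Fin M → ℝ} (hβ : ∀ k, β k ≤ β' k)
    (hlam : ∀ m, lam m ≤ lam' m) (k : Fin K) :
    interference h σ2 u β lam k ≤ interference h σ2 u β' lam' k := by
  unfold interference
  gcongr with j _ m _
  · exact Complex.normSq_nonneg _
  · exact hβ j
  · exact Complex.normSq_nonneg _
  · exact hlam m

lemma le_interference {M K : ℕ} (h : Fin M → Fin K → ℂ) (σ2 : ℝ) (u : Fin K → Fin M → ℂ)
    {β : Fin K → ℝ} {lam : Fin M → ℝ} (hβ : ∀ k, 0 ≤ β k) (hlam : ∀ m, 0 ≤ lam m) (k : Fin K) :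
    σ2 ≤ interference h σ2 u β lam k := by
  simpa [interference] using
    interference_mono h σ2 u (β := fun _ => 0) (lam := fun _ => 0) hβ hlam k

lemma eqFeas_iff {M K : ℕ} {h : Fin M → Fin K → ℂ} {σ2 : ℝ} {u : Fin K → Fin M → ℂ}
    {R : Fin K → ℝ} {C : Fin M → ℝ} {β : Fin K → ℝ} {lam : Fin M → ℝ} :
    EqFeas h σ2 u R C β lam ↔ (∀ k, 0 < β k) ∧ (∀ m, 0 < lam m) ∧
      (∀ k, interference h σ2 u β lam k = β k * gain h u R k) ∧
      ∀ m, (2:ℝ) ^ (C m) * lam m = (schurLead (Omega h σ2 β lam) m).re := by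
  simp only [EqFeas, interference, gain, mul_div_assoc]

lemma ineqFeas_iff {M K : ℕ} {h : Fin M → Fin K → ℂ} {σ2 : ℝ} {u : Fin K → Fin M → ℂ}
    {R : Fin K → ℝ} {C : Fin M → ℝ} {β : Fin K → ℝ} {lam : Fin M → ℝ} :
    IneqFeas h σ2 u R C β lam ↔ (∀ k, 0 < β k) ∧ (∀ m, 0 < lam m) ∧
      (∀ k, interference h σ2 u β lam k ≤ β k * gain h u R k) ∧
      ∀ m, (schurLead (Omega h σ2 β lam) m).re ≤ (2:ℝ) ^ (C m) * lam m := by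
  simp only [IneqFeas, interference, gain, mul_div_assoc, sub_nonpos]

lemma EqFeas.ineqFeas {M K : ℕ} {h : Fin M → Fin K → ℂ} {σ2 : ℝ} {u : Fin K → Fin M → ℂ}
    {R : Fin K → ℝ} {C : Fin M → ℝ} {β : Fin K → ℝ} {lam : Fin M → ℝ}
    (hf : EqFeas h σ2 u R C β lam) : IneqFeas h σ2 u R C β lam :=
  ⟨hf.1, hf.2.1, fun k => (sub_eq_zero.2 (hf.2.2.1 k)).le, fun m => (hf.2.2.2 m).ge⟩

/-- Every feasible point of the inequality system dominates a solution of the equality system. -/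
lemma IneqFeas.exists_eqFeas_le {M K : ℕ} {h : Fin M → Fin K → ℂ} {σ2 : ℝ} (hσ : 0 < σ2)
    {u : Fin K → Fin M → ℂ} {R : Fin K → ℝ} (hR : ∀ k, 0 < R k)
    (hch : ∀ k, dotH (u k) (hvec h k) ≠ 0) {C : Fin M → ℝ} {β : Fin K → ℝ} {lam : Fin M → ℝ}
    (hf : IneqFeas h σ2 u R C β lam) :
    ∃ β' lam', EqFeas h σ2 u R C β' lam' ∧ (∀ k, β' k ≤ β k) ∧ ∀ m, lam' m ≤ lam m := by
  obtain ⟨hβ, hlam, hI, hS⟩ := ineqFeas_iff.1 hf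
  have hg := gain_pos hR hch
  have hp : ∀ m, (0:ℝ) < 2 ^ C m := fun m => Real.rpow_pos_of_pos two_pos _
  let T : (Fin K ⊕ Fin M → ℝ) → Fin K ⊕ Fin M → ℝ := fun x =>
    Sum.elim (fun k => interference h σ2 u (x ∘ Sum.inl) (x ∘ Sum.inr) k / gain h u R k)
      (fun m => (schurLead (Omega h σ2 (x ∘ Sum.inl) (x ∘ Sum.inr)) m).re / 2 ^ C m)
  let c : Fin K ⊕ Fin M → ℝ := Sum.elim (fun k => σ2 / gain h u R k) (fun m => σ2 / 2 ^ C m)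
  have hc0 : ∀ i, 0 < c i := by
    rintro (k | m)
    · exact div_pos hσ (hg k)
    · exact div_pos hσ (hp m)
  have hmono : ∀ x y, c ≤ x → x ≤ y → T x ≤ T y := by
    rintro x y hx hxy (k | m)
    · exact div_le_div_of_nonneg_right
        (interference_mono h σ2 u (fun k => hxy (.inl k)) (fun m => hxy (.inr m)) k) (hg k).le
    · exact div_le_div_of_nonneg_right
        (schurLead_Omega_mono h hσ (fun k => (hc0 (.inl k)).le.trans (hx _))
          (fun m => (hc0 (.inr m)).le.trans (hx _)) (fun k => hxy (.inl k))
          (fun m => hxy (.inr m)) m) (hp m).le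
  have hcT : ∀ x, 0 ≤ x → c ≤ T x := by
    rintro x hx (k | m)
    · exact div_le_div_of_nonneg_right
        (le_interference h σ2 u (fun k => hx (.inl k)) (fun m => hx (.inr m)) k) (hg k).le
    · exact div_le_div_of_nonneg_right
        (le_schurLead_Omega h hσ (fun k => hx (.inl k)) (fun m => hx (.inr m)) m) (hp m).le
  have hT : T (Sum.elim β lam) ≤ Sum.elim β lam := by
    rintro (k | m)
    · exact (div_le_iff₀ (hg k)).2 (hI k)
    · exact (div_le_iff₀ (hp m)).2 ((hS m).trans_eq (mul_comm _ _))
  have h0 : (0 : Fin K ⊕ Fin M → ℝ) ≤ Sum.elim β lam := by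
    rintro (k | m)
    · exact (hβ k).le
    · exact (hlam m).le
  obtain ⟨x, hcx, hx, hfix⟩ := exists_fixedPoint_le T c (Sum.elim β lam) ((hcT _ h0).trans hT)
    hmono (fun x hx => hcT x fun i => (hc0 i).le.trans (hx i)) hT
  refine ⟨x ∘ Sum.inl, x ∘ Sum.inr, eqFeas_iff.2 ⟨fun k => (hc0 _).trans_le (hcx _),
    fun m => (hc0 _).trans_le (hcx _), fun k => ?_, fun m => ?_⟩, fun k => hx (.inl k),
    fun m => hx (.inr m)⟩
  · exact (div_eq_iff (hg k).ne').1 (congrFun hfix (.inl k))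
  · rw [mul_comm]
    exact ((div_eq_iff (hp m).ne').1 (congrFun hfix (.inr m))).symm

lemma eq_of_forall_le_of_sum_le {ι : Type*} [Fintype ι] {f g : ι → ℝ} (hfg : ∀ i, f i ≤ g i)
    (hsum : ∑ i, g i ≤ ∑ i, f i) : f = g :=
  funext fun i => (Finset.sum_eq_sum_iff_of_le fun i _ => hfg i).1
    ((Finset.sum_le_sum fun i _ => hfg i).antisymm hsum) i (Finset.mem_univ i)

/-- If every `m` is seen by some receiver, a decrease of the quantization noise that leaves every
interference unchanged is trivial. -/
lemma eq_of_interference_le {M K : ℕ} {h : Fin M → Fin K → ℂ} {σ2 : ℝ} {u : Fin K → Fin M → ℂ}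
    (hcov : ∀ m, 0 < ∑ k, Complex.normSq (u k m)) {β : Fin K → ℝ} {lam lam' : Fin M → ℝ}
    (hle : ∀ m, lam' m ≤ lam m)
    (hI : ∀ k, interference h σ2 u β lam k ≤ interference h σ2 u β lam' k) : lam' = lam := by
  funext m
  obtain ⟨k, -, hk⟩ := Finset.exists_lt_of_sum_lt
    (show ∑ _k : Fin K, (0:ℝ) < ∑ k, Complex.normSq (u k m) by simpa using hcov m)
  have hsum : ∑ m, lam m * Complex.normSq (u k m) ≤ ∑ m, lam' m * Complex.normSq (u k m) := by
    simpa [interference] using hI k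
  have heq := eq_of_forall_le_of_sum_le
    (fun m => mul_le_mul_of_nonneg_right (hle m) (Complex.normSq_nonneg (u k m))) hsum
  exact mul_right_cancel₀ hk.ne' (congrFun heq m)

/-- **Equivalence of the equality-constrained and inequality-constrained uplink
power-minimization problems**: the two infima coincide, and every optimal solution
of the inequality-constrained problem satisfies all constraints with equality. -/
theorem eq_ineq_uplink_power_min_equiv
    (M K : ℕ) (h : Fin M → Fin K → ℂ) (σ2 : ℝ) (hσ : 0 < σ2)
    (u : Fin K → Fin M → ℂ) (hcov : ∀ m, 0 < ∑ k, Complex.normSq (u k m))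
    (R : Fin K → ℝ) (hR : ∀ k, 0 < R k)
    (hch : ∀ k, dotH (u k) (hvec h k) ≠ 0)
    (C : Fin M → ℝ) (hC : ∀ m, 0 < C m) :
    (sInf {x : ℝ | ∃ (β : Fin K → ℝ) (lam : Fin M → ℝ),
        EqFeas h σ2 u R C β lam ∧ x = σ2 * ∑ k, β k}
      = sInf {x : ℝ | ∃ (β : Fin K → ℝ) (lam : Fin M → ℝ),
        IneqFeas h σ2 u R C β lam ∧ x = σ2 * ∑ k, β k}) ∧
    (∀ (β : Fin K → ℝ) (lam : Fin M → ℝ), IneqFeas h σ2 u R C β lam →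
      (∀ (β' : Fin K → ℝ) (lam' : Fin M → ℝ), IneqFeas h σ2 u R C β' lam' →
        σ2 * ∑ k, β k ≤ σ2 * ∑ k, β' k) →
      EqFeas h σ2 u R C β lam) := by
  refine ⟨?_, fun β lam hf hopt => ?_⟩
  · set E : Set ℝ := {x | ∃ β lam, EqFeas h σ2 u R C β lam ∧ x = σ2 * ∑ k, β k}
    set I : Set ℝ := {x | ∃ β lam, IneqFeas h σ2 u R C β lam ∧ x = σ2 * ∑ k, β k}
    have hEI : E ⊆ I := fun x ⟨β, lam, hf, hx⟩ => ⟨β, lam, hf.ineqFeas, hx⟩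
    have hIE : ∀ x ∈ I, ∃ y ∈ E, y ≤ x := by
      rintro x ⟨β, lam, hf, rfl⟩
      obtain ⟨β', lam', hf', hβ, -⟩ := hf.exists_eqFeas_le hσ hR hch
      exact ⟨_, ⟨β', lam', hf', rfl⟩,
        mul_le_mul_of_nonneg_left (Finset.sum_le_sum fun k _ => hβ k) hσ.le⟩
    have hbI : BddBelow I := by
      refine ⟨0, ?_⟩
      rintro x ⟨β, lam, hf, rfl⟩
      exact mul_nonneg hσ.le (Finset.sum_nonneg fun k _ => (hf.1 k).le)
    rcases I.eq_empty_or_nonempty with hI | ⟨x, hx⟩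
    · rw [hI, Set.subset_empty_iff.1 (hEI.trans hI.subset)]
    · obtain ⟨y, hy, -⟩ := hIE x hx
      refine le_antisymm (le_csInf ⟨x, hx⟩ fun z hz => ?_) (csInf_le_csInf hbI ⟨y, hy⟩ hEI)
      obtain ⟨w, hw, hwz⟩ := hIE z hz
      exact (csInf_le (hbI.mono hEI) hw).trans hwz
  · obtain ⟨β', lam', hf', hβ, hlam⟩ := hf.exists_eqFeas_le hσ hR hch
    obtain rfl := eq_of_forall_le_of_sum_le hβ
      (le_of_mul_le_mul_left (hopt β' lam' hf'.ineqFeas) hσ)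
    obtain rfl := eq_of_interference_le hcov hlam fun k =>
      ((ineqFeas_iff.1 hf).2.2.1 k).trans_eq ((eqFeas_iff.1 hf').2.2.1 k).symm
    exact hf'

end Stmt13
end
end

section
/- Standard-interference-function property for Case I (Lemma 1): For p ∈ ℝ_{≥0}^K define quantization noise levels q_m(p) = (Σ_{k=1}^K p_k|h_{m,k}|² + σ²)/(2^{C_m}−1) for m = 1,…,M, and for each k define I_k(p) = (2^{R_k}−1)/(h_k^H (Σ_{j≠k} p_j h_j h_j^H + diag(q_1(p),…,q_M(p)) + σ²I)^{−1} h_k). Assume σ² > 0, C_m > 0 for all m, and R_k > 0, h_k ≠ 0 for all k. Then for all p ∈ ℝ_{≥0}^K: (1) I_k(p) > 0 for every k; (2) for every α > 1, I_k(αp) < α·I_k(p) for every k; (3) if p̄ ∈ ℝ_{≥0}^K satisfies p̄ ≥ p componentwise, then I_k(p̄) ≥ I_k(p) for every k. -/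
open Finset Matrix

noncomputable section

namespace Stmt14

/-- channel vector of user `k` (column of the `M × K` uplink channel matrix). -/
def hvec {M K : ℕ} (h : Fin M → Fin K → ℂ) (k : Fin K) : Fin M → ℂ := fun m => h m k

/-- the optimal quantization noise level of relay `m` as a function of the powers. -/
def qIN {M K : ℕ} (h : Fin M → Fin K → ℂ) (σ2 : ℝ) (C : Fin M → ℝ)
    (p : Fin K → ℝ) (m : Fin M) : ℝ :=
  (∑ k, p k * Complex.normSq (h m k) + σ2) / ((2:ℝ) ^ (C m) - 1)

/-- the matrix `Σ_{j≠k} p_j h_j h_j^H + diag(q(p)) + σ²I`. -/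
def interfMat {M K : ℕ} (h : Fin M → Fin K → ℂ) (σ2 : ℝ) (C : Fin M → ℝ)
    (p : Fin K → ℝ) (k : Fin K) : Matrix (Fin M) (Fin M) ℂ :=
  fun i j => (∑ l ∈ Finset.univ.erase k, (p l : ℂ) * h i l * (starRingEnd ℂ) (h j l)) +
    (if i = j then ((qIN h σ2 C p i + σ2 : ℝ) : ℂ) else 0)

/-- the standard interference function
`I_k(p) = (2^{R_k}-1) / (h_k^H (Σ_{j≠k} p_j h_j h_j^H + diag(q(p)) + σ²I)⁻¹ h_k)`. -/
def Ifun {M K : ℕ} (h : Fin M → Fin K → ℂ) (σ2 : ℝ) (R : Fin K → ℝ) (C : Fin M → ℝ)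
    (p : Fin K → ℝ) (k : Fin K) : ℝ :=
  ((2:ℝ) ^ (R k) - 1) /
    (∑ i, ∑ j, (starRingEnd ℂ) (h i k) * (interfMat h σ2 C p k)⁻¹ i j * h j k).re

open scoped ComplexOrder

/-- The Hermitian matrix `Σ_{l ∈ s} w_l v_l v_l^H + diag(d)`. -/
def weightedGram {ι κ : Type*} [DecidableEq ι] (s : Finset κ) (v : κ → ι → ℂ) (w : κ → ℝ)
    (d : ι → ℝ) : Matrix ι ι ℂ :=
  ∑ l ∈ s, w l • vecMulVec (v l) (star (v l)) + diagonal fun i => (d i : ℂ)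

section WeightedGram

variable {ι κ : Type*}

lemma posSemidef_sum_smul_vecMulVec [Finite ι] (s : Finset κ) (v : κ → ι → ℂ) {w : κ → ℝ}
    (hw : ∀ l, 0 ≤ w l) :
    (∑ l ∈ s, w l • vecMulVec (v l) (star (v l))).PosSemidef :=
  posSemidef_sum s fun l _ => (posSemidef_vecMulVec_self_star (v l)).smul (hw l)

variable [DecidableEq ι]

lemma weightedGram_posSemidef [Finite ι] (s : Finset κ) (v : κ → ι → ℂ) {w : κ → ℝ}
    {d : ι → ℝ} (hw : ∀ l, 0 ≤ w l) (hd : ∀ i, 0 ≤ d i) : (weightedGram s v w d).PosSemidef :=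
  (posSemidef_sum_smul_vecMulVec s v hw).add
    (PosSemidef.diagonal fun i => by simpa using hd i)

lemma weightedGram_posDef [Finite ι] (s : Finset κ) (v : κ → ι → ℂ) {w : κ → ℝ}
    {d : ι → ℝ} (hw : ∀ l, 0 ≤ w l) (hd : ∀ i, 0 < d i) : (weightedGram s v w d).PosDef :=
  PosDef.posSemidef_add (posSemidef_sum_smul_vecMulVec s v hw)
    (PosDef.diagonal fun i => by simpa using hd i)

lemma weightedGram_sub (s : Finset κ) (v : κ → ι → ℂ) (w w' : κ → ℝ) (d d' : ι → ℝ) :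
    weightedGram s v w d - weightedGram s v w' d' = weightedGram s v (w - w') (d - d') := by
  ext i j
  by_cases hij : i = j <;>
    simp [weightedGram, Matrix.sum_apply, sub_mul, Finset.sum_sub_distrib, hij]
  ring

lemma smul_weightedGram (s : Finset κ) (v : κ → ι → ℂ) (w : κ → ℝ) (d : ι → ℝ) (a : ℝ) :
    a • weightedGram s v w d = weightedGram s v (a • w) (a • d) := by
  ext i j
  by_cases hij : i = j <;>
    simp [weightedGram, Matrix.sum_apply, Finset.mul_sum, hij, mul_assoc]

end WeightedGram

section InverseOrder

variable {ι : Type*} [Fintype ι] [DecidableEq ι]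

/-- With `y = B⁻¹ v`, the increase of `v^H A⁻¹ v` over `v^H B⁻¹ v` is at least
`y^H (B - A) y`. -/
lemma re_dotProduct_inv_add_le {A B : Matrix ι ι ℂ} (hA : A.PosDef) (hB : B.PosDef)
    (v : ι → ℂ) :
    (star v ⬝ᵥ B⁻¹ *ᵥ v).re + (star (B⁻¹ *ᵥ v) ⬝ᵥ (B - A) *ᵥ (B⁻¹ *ᵥ v)).re ≤
      (star v ⬝ᵥ A⁻¹ *ᵥ v).re := by
  obtain ⟨x, hx⟩ : ∃ x, x = A⁻¹ *ᵥ v := ⟨_, rfl⟩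
  obtain ⟨y, hy⟩ : ∃ y, y = B⁻¹ *ᵥ v := ⟨_, rfl⟩
  have hAx : A *ᵥ x = v := by
    rw [hx, mulVec_mulVec, mul_nonsing_inv _ ((isUnit_iff_isUnit_det A).1 hA.isUnit), one_mulVec]
  have hBy : B *ᵥ y = v := by
    rw [hy, mulVec_mulVec, mul_nonsing_inv _ ((isUnit_iff_isUnit_det B).1 hB.isUnit), one_mulVec]
  have hxA : star x ᵥ* A = star v := by
    rw [← hAx, star_mulVec, hA.isHermitian.eq]
  have hre (z : ι → ℂ) : (star z ⬝ᵥ v).re = (star v ⬝ᵥ z).re := by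
    rw [star_dotProduct, dotProduct_comm]
    simp
  have hpos : 0 ≤ (star (x - y) ⬝ᵥ A *ᵥ (x - y)).re :=
    hA.posSemidef.re_dotProduct_nonneg (x - y)
  rw [← hx, ← hy, sub_mulVec, hBy]
  rw [mulVec_sub, hAx, star_sub, sub_dotProduct, dotProduct_sub, dotProduct_sub,
    dotProduct_mulVec (star x) A y, hxA] at hpos
  simp only [Complex.sub_re, dotProduct_sub] at hpos ⊢
  linarith [hre x, hre y]

lemma re_dotProduct_inv_pos {A : Matrix ι ι ℂ} (hA : A.PosDef) {v : ι → ℂ} (hv : v ≠ 0) :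
    0 < (star v ⬝ᵥ A⁻¹ *ᵥ v).re :=
  hA.inv.re_dotProduct_pos hv

lemma re_dotProduct_inv_le {A B : Matrix ι ι ℂ} (hA : A.PosDef) (hB : B.PosDef)
    (hAB : (B - A).PosSemidef) (v : ι → ℂ) :
    (star v ⬝ᵥ B⁻¹ *ᵥ v).re ≤ (star v ⬝ᵥ A⁻¹ *ᵥ v).re := by
  have h₁ := re_dotProduct_inv_add_le hA hB v
  have h₂ : 0 ≤ (star (B⁻¹ *ᵥ v) ⬝ᵥ (B - A) *ᵥ (B⁻¹ *ᵥ v)).re := hAB.re_dotProduct_nonneg _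
  linarith

lemma re_dotProduct_inv_lt {A B : Matrix ι ι ℂ} (hA : A.PosDef) (hB : B.PosDef)
    (hAB : (B - A).PosDef) {v : ι → ℂ} (hv : v ≠ 0) :
    (star v ⬝ᵥ B⁻¹ *ᵥ v).re < (star v ⬝ᵥ A⁻¹ *ᵥ v).re := by
  have h₁ := re_dotProduct_inv_add_le hA hB v
  have hy : B⁻¹ *ᵥ v ≠ 0 := fun h0 => by
    simpa [h0] using re_dotProduct_inv_pos hB hv
  have h₂ : 0 < (star (B⁻¹ *ᵥ v) ⬝ᵥ (B - A) *ᵥ (B⁻¹ *ᵥ v)).re := hAB.re_dotProduct_pos hy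
  linarith

end InverseOrder

section Interference

variable {M K : ℕ} (h : Fin M → Fin K → ℂ) (σ2 : ℝ) (R : Fin K → ℝ) (C : Fin M → ℝ)
  (p : Fin K → ℝ) (k : Fin K)

lemma interfMat_eq_weightedGram :
    interfMat h σ2 C p k =
      weightedGram (univ.erase k) (hvec h) p (fun m => qIN h σ2 C p m + σ2) := by
  ext i j
  simp [interfMat, weightedGram, Matrix.sum_apply, diagonal_apply, vecMulVec_apply, hvec,
    mul_assoc]

lemma Ifun_eq_div :
    Ifun h σ2 R C p k = ((2 : ℝ) ^ R k - 1) /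
      (star (hvec h k) ⬝ᵥ (interfMat h σ2 C p k)⁻¹ *ᵥ hvec h k).re := by
  simp [Ifun, dotProduct, mulVec, Finset.mul_sum, mul_assoc, hvec]

variable {h σ2 R C p k}

lemma two_rpow_sub_one_pos {x : ℝ} (hx : 0 < x) : 0 < (2 : ℝ) ^ x - 1 :=
  sub_pos.2 (Real.one_lt_rpow one_lt_two hx)

lemma qIN_nonneg (hσ : 0 < σ2) (hC : ∀ m, 0 < C m) (hp : ∀ k, 0 ≤ p k) (m : Fin M) :
    0 ≤ qIN h σ2 C p m :=
  div_nonneg (add_nonneg (sum_nonneg fun k _ => mul_nonneg (hp k) (Complex.normSq_nonneg _))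
    hσ.le) (two_rpow_sub_one_pos (hC m)).le

lemma qIN_mono (hC : ∀ m, 0 < C m) {p' : Fin K → ℝ} (hpp' : ∀ k, p k ≤ p' k) (m : Fin M) :
    qIN h σ2 C p m ≤ qIN h σ2 C p' m := by
  have := two_rpow_sub_one_pos (hC m)
  unfold qIN
  gcongr with l
  · exact Complex.normSq_nonneg _
  · exact hpp' l

lemma qIN_smul_le (hσ : 0 < σ2) (hC : ∀ m, 0 < C m) {a : ℝ} (ha : 1 < a) (m : Fin M) :
    qIN h σ2 C (a • p) m ≤ a * qIN h σ2 C p m := by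
  have := two_rpow_sub_one_pos (hC m)
  unfold qIN
  rw [← mul_div_assoc, mul_add, Finset.mul_sum]
  simp only [Pi.smul_apply, smul_eq_mul, mul_assoc]
  gcongr
  nlinarith

lemma interfMat_posDef (hσ : 0 < σ2) (hC : ∀ m, 0 < C m) (hp : ∀ k, 0 ≤ p k) :
    (interfMat h σ2 C p k).PosDef := by
  rw [interfMat_eq_weightedGram]
  exact weightedGram_posDef _ _ hp fun m => add_pos_of_nonneg_of_pos (qIN_nonneg hσ hC hp m) hσ

lemma interfMat_sub_posSemidef (hC : ∀ m, 0 < C m) {p' : Fin K → ℝ}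
    (hpp' : ∀ k, p k ≤ p' k) : (interfMat h σ2 C p' k - interfMat h σ2 C p k).PosSemidef := by
  rw [interfMat_eq_weightedGram, interfMat_eq_weightedGram, weightedGram_sub]
  refine weightedGram_posSemidef _ _ (fun l => sub_nonneg.2 (hpp' l)) fun m => ?_
  simpa using qIN_mono hC hpp' m

lemma smul_interfMat_sub_posDef (hσ : 0 < σ2) (hC : ∀ m, 0 < C m) {a : ℝ} (ha : 1 < a) :
    (a • interfMat h σ2 C p k - interfMat h σ2 C (a • p) k).PosDef := by
  rw [interfMat_eq_weightedGram, interfMat_eq_weightedGram, smul_weightedGram, weightedGram_sub]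
  refine weightedGram_posDef _ _ (fun l => by simp) fun m => ?_
  have := qIN_smul_le (h := h) (p := p) hσ hC ha m
  simp only [Pi.sub_apply, Pi.smul_apply, smul_eq_mul]
  nlinarith

end Interference

/-- **Lemma 1** (standard-interference-function property for Case I): the map `I`
is positive, strictly sub-homogeneous, and monotone. -/
theorem interference_function_caseI
    (M K : ℕ) (h : Fin M → Fin K → ℂ) (σ2 : ℝ) (hσ : 0 < σ2)
    (R : Fin K → ℝ) (hR : ∀ k, 0 < R k)
    (C : Fin M → ℝ) (hC : ∀ m, 0 < C m)
    (hch : ∀ k, hvec h k ≠ 0)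
    (p : Fin K → ℝ) (hp : ∀ k, 0 ≤ p k) :
    (∀ k, 0 < Ifun h σ2 R C p k) ∧
    (∀ α : ℝ, 1 < α → ∀ k, Ifun h σ2 R C (fun i => α * p i) k < α * Ifun h σ2 R C p k) ∧
    (∀ pbar : Fin K → ℝ, (∀ i, 0 ≤ pbar i) → (∀ i, p i ≤ pbar i) →
      ∀ k, Ifun h σ2 R C p k ≤ Ifun h σ2 R C pbar k) := by
  have hpd : ∀ p' : Fin K → ℝ, (∀ k, 0 ≤ p' k) → ∀ k, (interfMat h σ2 C p' k).PosDef :=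
    fun p' hp' k => interfMat_posDef hσ hC hp'
  refine ⟨fun k => ?_, fun a ha k => ?_, fun p' hp' hpp' k => ?_⟩
  · rw [Ifun_eq_div]
    exact div_pos (two_rpow_sub_one_pos (hR k)) (re_dotProduct_inv_pos (hpd p hp k) (hch k))
  · have ha0 : 0 < a := one_pos.trans ha
    have hap : ∀ i, 0 ≤ (a • p) i := fun i => mul_nonneg ha0.le (hp i)
    have hlt := re_dotProduct_inv_lt (hpd _ hap k) ((hpd p hp k).smul ha0)
      (smul_interfMat_sub_posDef hσ hC ha) (hch k)
    have hinv : (a • interfMat h σ2 C p k)⁻¹ = a⁻¹ • (interfMat h σ2 C p k)⁻¹ := by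
      have hdet := (isUnit_iff_isUnit_det _).1 (hpd p hp k).isUnit
      refine inv_eq_right_inv ?_
      rw [smul_mul_smul_comm, mul_inv_cancel₀ ha0.ne', mul_nonsing_inv _ hdet, one_smul]
    rw [hinv, smul_mulVec, dotProduct_smul, Complex.smul_re, smul_eq_mul] at hlt
    have hpos := re_dotProduct_inv_pos (hpd p hp k) (hch k)
    change Ifun h σ2 R C (a • p) k < _
    rw [Ifun_eq_div, Ifun_eq_div]
    calc _ < _ := div_lt_div_of_pos_left (two_rpow_sub_one_pos (hR k))
          (mul_pos (inv_pos.2 ha0) hpos) hlt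
      _ = _ := by field_simp
  · rw [Ifun_eq_div, Ifun_eq_div]
    exact div_le_div_of_nonneg_left (two_rpow_sub_one_pos (hR k)).le
      (re_dotProduct_inv_pos (hpd p' hp' k) (hch k))
      (re_dotProduct_inv_le (hpd p hp k) (hpd p' hp' k) (interfMat_sub_posSemidef hC hpp') _)

end Stmt14
end
end

section
/- Standard-interference-function property of the dual uplink map with Wyner-Ziv quantization noises (Lemma, Appendix G): For β ∈ ℝ_{≥0}^K let λ(β) ∈ ℝ^M be defined recursively by λ_1(β) = (σ² + Σ_{k=1}^K β_k|h_{1,k}|²)/(2^{C_1}−1) and, for m ≥ 2, λ_m(β) = (σ² + Σ_k β_k|h_{m,k}|² − Ω^{(m,1:m−1)}(Ω^{(1:m−1,1:m−1)})^{−1}Ω^{(1:m−1,m)})/(2^{C_m}−1), where Ω = σ²I + Σ_k β_k h_k h_k^H + diag(λ_1(β),…,λ_M(β)) (only λ_1(β),…,λ_{m−1}(β) enter the m-th equation, so the recursion is well defined). For each k define I_k(β) = (2^{R_k}−1)(σ² + Σ_{j≠k} β_j|ū_k^H h_j|² + Σ_{m=1}^M λ_m(β)|ū_{k,m}|²)/|ū_k^H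 h_k|². Assume σ² > 0, C_m > 0 for all m, and R_k > 0, ū_k^H h_k ≠ 0 for all k. Then for all β ∈ ℝ_{≥0}^K: (1) I_k(β) > 0 for every k; (2) for every α > 1, I_k(αβ) < α·I_k(β) for every k; (3) if β̄ ≥ β componentwise then I_k(β̄) ≥ I_k(β) for every k. -/
open Finset Matrix

noncomputable section

namespace Stmt15

/-- Hermitian inner product `x^H y`. -/
def dotH {M : ℕ} (x y : Fin M → ℂ) : ℂ := ∑ m, (starRingEnd ℂ) (x m) * y m

/-- channel vector of user `k` (column of the `M × K` uplink channel matrix). -/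
def hvec {M K : ℕ} (h : Fin M → Fin K → ℂ) (k : Fin K) : Fin M → ℂ := fun m => h m k

/-- `X^{(m,1:m-1)} (X^{(1:m-1,1:m-1)})⁻¹ X^{(1:m-1,m)}` (equal to `0` for the first index). -/
def leadProd {n : ℕ} (X : Matrix (Fin n) (Fin n) ℂ) (m : Fin n) : ℂ :=
  ∑ i : Fin m.val, ∑ j : Fin m.val,
    X m (Fin.castLE m.isLt.le i) *
      (X.submatrix (Fin.castLE m.isLt.le) (Fin.castLE m.isLt.le))⁻¹ i j *
      X (Fin.castLE m.isLt.le j) m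

/-- The recursively defined Wyner-Ziv uplink quantization-noise map
`λ_m(β)` (only `λ_1(β), …, λ_{m−1}(β)` enter the `m`-th equation). -/
def lamAux (M K : ℕ) (h : Fin M → Fin K → ℂ) (σ2 : ℝ) (C : Fin M → ℝ)
    (β : Fin K → ℝ) : (m : ℕ) → m < M → ℝ
  | m, hm =>
    (σ2 + ∑ k, β k * Complex.normSq (h ⟨m, hm⟩ k) -
      (leadProd (fun i j : Fin M =>
        (∑ k, (β k : ℂ) * h i k * (starRingEnd ℂ) (h j k)) +
        (if i = j then
          (if hi : i.val < m then
            ((σ2 + lamAux M K h σ2 C β i.val (hi.trans hm) : ℝ) : ℂ)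
           else ((σ2 : ℝ) : ℂ))
         else 0)) ⟨m, hm⟩).re) / ((2:ℝ) ^ (C ⟨m, hm⟩) - 1)
  termination_by m _ => m

/-- `λ(β)` as a vector indexed by `Fin M`. -/
def lam (M K : ℕ) (h : Fin M → Fin K → ℂ) (σ2 : ℝ) (C : Fin M → ℝ)
    (β : Fin K → ℝ) (m : Fin M) : ℝ :=
  lamAux M K h σ2 C β m.val m.isLt

/-- the dual uplink interference map
`I_k(β) = (2^{R_k}−1)(σ² + Σ_{j≠k} β_j|ū_k^H h_j|² + Σ_m λ_m(β)|ū_{k,m}|²)/|ū_k^H h_k|²`. -/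
def Ifun (M K : ℕ) (h : Fin M → Fin K → ℂ) (σ2 : ℝ) (u : Fin K → Fin M → ℂ)
    (R : Fin K → ℝ) (C : Fin M → ℝ) (β : Fin K → ℝ) (k : Fin K) : ℝ :=
  ((2:ℝ) ^ (R k) - 1) *
      (σ2 + ∑ j ∈ Finset.univ.erase k, β j * Complex.normSq (dotH (u k) (hvec h j)) +
        ∑ m, lam M K h σ2 C β m * Complex.normSq (u k m)) /
    Complex.normSq (dotH (u k) (hvec h k))

/-- The mean squared error of the linear estimate of the signal with channel `a` from the signals
with channels `g i` and quantization noises `l i`, with coefficients `star (z i)`. -/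
def estError {ι κ : Type*} [Fintype ι] [Fintype κ] (σ2 : ℝ) (g : ι → κ → ℂ) (a : κ → ℂ)
    (β : κ → ℝ) (l : ι → ℝ) (z : ι → ℂ) : ℝ :=
  σ2 + ∑ k, β k * Complex.normSq (a k - ∑ i, star (z i) * g i k) +
    ∑ i, (σ2 + l i) * Complex.normSq (z i)

/-- The covariance matrix of the signals with channels `g i` and quantization noises `l i`. -/
def covMatrix {ι κ : Type*} [DecidableEq ι] [Fintype κ] (σ2 : ℝ) (g : ι → κ → ℂ)
    (β : κ → ℝ) (l : ι → ℝ) : Matrix ι ι ℂ :=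
  fun i j => (∑ k, (β k : ℂ) * g i k * star (g j k)) + if i = j then ((σ2 + l i : ℝ) : ℂ) else 0

/-- The cross-covariance vector of the signals with channels `g i` and the signal with
channel `a`. -/
def crossCov {ι κ : Type*} [Fintype κ] (g : ι → κ → ℂ) (a : κ → ℂ) (β : κ → ℝ) : ι → ℂ :=
  fun i => ∑ k, (β k : ℂ) * g i k * star (a k)

theorem covMatrix_eq {ι κ : Type*} [DecidableEq ι] [Fintype κ] [DecidableEq κ] (σ2 : ℝ)
    (g : ι → κ → ℂ) (β : κ → ℝ) (l : ι → ℝ) :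
    covMatrix σ2 g β l =
      Matrix.of g * diagonal (fun k => (β k : ℂ)) * (Matrix.of g)ᴴ +
        diagonal (fun i => ((σ2 + l i : ℝ) : ℂ)) := by
  ext i j
  simp [covMatrix, Matrix.mul_apply, Matrix.diagonal_apply, mul_comm]

section Estimation

open scoped ComplexOrder

variable {ι κ : Type*} [Fintype ι] [Fintype κ] {σ2 : ℝ} {g : ι → κ → ℂ} {a : κ → ℂ}

theorem estError_nonneg (hσ : 0 ≤ σ2) {β : κ → ℝ} (hβ : ∀ k, 0 ≤ β k) {l : ι → ℝ}
    (hl : ∀ i, 0 ≤ l i) (z : ι → ℂ) : 0 ≤ estError σ2 g a β l z :=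
  add_nonneg (add_nonneg hσ (sum_nonneg fun k _ => mul_nonneg (hβ k) (Complex.normSq_nonneg _)))
    (sum_nonneg fun i _ => mul_nonneg (add_nonneg hσ (hl i)) (Complex.normSq_nonneg _))

theorem estError_mono {β β' : κ → ℝ} (hβ : ∀ k, β k ≤ β' k) {l l' : ι → ℝ}
    (hl : ∀ i, l i ≤ l' i) (z : ι → ℂ) : estError σ2 g a β l z ≤ estError σ2 g a β' l' z := by
  unfold estError
  gcongr with k _ i _
  · exact Complex.normSq_nonneg _
  · exact hβ k
  · exact Complex.normSq_nonneg _
  · exact hl i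

theorem estError_smul_le (hσ : 0 ≤ σ2) (β : κ → ℝ) (l : ι → ℝ) {α : ℝ} (hα : 1 ≤ α)
    (z : ι → ℂ) :
    estError σ2 g a (fun k => α * β k) (fun i => α * l i) z ≤ α * estError σ2 g a β l z := by
  have hσα : σ2 ≤ α * σ2 := le_mul_of_one_le_left hσ hα
  simp only [estError, mul_add, mul_sum]
  refine add_le_add (add_le_add hσα (sum_le_sum fun k _ => (mul_assoc _ _ _).le))
    (sum_le_sum fun i _ => ?_)
  rw [← mul_assoc, mul_add]
  exact mul_le_mul_of_nonneg_right (by gcongr) (Complex.normSq_nonneg _)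

theorem star_dotProduct_crossCov (β : κ → ℝ) (z : ι → ℂ) :
    star z ⬝ᵥ crossCov g a β = ∑ k, (β k : ℂ) * ((∑ i, star (z i) * g i k) * star (a k)) := by
  simp only [dotProduct, crossCov, mul_sum, sum_mul, Pi.star_apply]
  rw [sum_comm]
  exact sum_congr rfl fun _ _ => sum_congr rfl fun _ _ => by ring

variable [DecidableEq ι]

theorem covMatrix_posDef (hσ : 0 < σ2) {β : κ → ℝ} (hβ : ∀ k, 0 ≤ β k) {l : ι → ℝ}
    (hl : ∀ i, 0 ≤ l i) : (covMatrix σ2 g β l).PosDef := by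
  classical
  rw [covMatrix_eq]
  refine Matrix.PosDef.posSemidef_add ?_ ?_
  · refine Matrix.PosSemidef.mul_mul_conjTranspose_same (Matrix.PosSemidef.diagonal fun k => ?_) _
    exact Complex.zero_le_real.2 (hβ k)
  · refine Matrix.PosDef.diagonal fun i => ?_
    exact_mod_cast add_pos_of_pos_of_nonneg hσ (hl i)

theorem star_dotProduct_covMatrix (β : κ → ℝ) (l : ι → ℝ) (z : ι → ℂ) :
    star z ⬝ᵥ covMatrix σ2 g β l *ᵥ z =
      ∑ k, (β k : ℂ) * ((∑ i, star (z i) * g i k) * star (∑ i, star (z i) * g i k)) +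
        ∑ i, ((σ2 + l i : ℝ) : ℂ) * (z i * star (z i)) := by
  classical
  have hv : star z ᵥ* Matrix.of g = fun k => ∑ i, star (z i) * g i k := by
    ext k; simp [Matrix.vecMul, dotProduct]
  have hw : (Matrix.of g)ᴴ *ᵥ z = fun k => star (∑ i, star (z i) * g i k) := by
    ext k; simp [Matrix.mulVec, dotProduct, mul_comm]
  rw [covMatrix_eq, Matrix.add_mulVec, dotProduct_add, ← Matrix.mulVec_mulVec,
    ← Matrix.mulVec_mulVec, Matrix.dotProduct_mulVec, hv, hw]
  congr 1
  · simp only [dotProduct, Matrix.mulVec_diagonal]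
    exact sum_congr rfl fun k _ => by ring
  · simp only [dotProduct, Matrix.mulVec_diagonal, Pi.star_apply]
    exact sum_congr rfl fun i _ => by ring

theorem estError_eq (β : κ → ℝ) (l : ι → ℝ) (z : ι → ℂ) :
    estError σ2 g a β l z =
      σ2 + ∑ k, β k * Complex.normSq (a k) - 2 * (star z ⬝ᵥ crossCov g a β).re +
        (star z ⬝ᵥ covMatrix σ2 g β l *ᵥ z).re := by
  rw [star_dotProduct_covMatrix, star_dotProduct_crossCov]
  simp only [Complex.add_re, Complex.re_sum, Complex.re_ofReal_mul, estError, mul_sum]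
  have hn (x : ℂ) : (x * star x).re = Complex.normSq x := by
    simp [Complex.mul_conj]
  simp only [hn]
  have hk (x y : ℂ) (b : ℝ) : b * Complex.normSq (y - x) =
      b * Complex.normSq y - 2 * (b * (x * star y).re) + b * Complex.normSq x := by
    rw [Complex.normSq_sub, ← Complex.conj_re (y * _), map_mul, Complex.conj_conj, mul_comm _ x,
      Complex.star_def]
    ring
  simp only [hk, sum_add_distrib, sum_sub_distrib]
  ring

/-- The Schur complement is the minimum mean squared error. -/
theorem isLeast_estError (hσ : 0 < σ2) {β : κ → ℝ} (hβ : ∀ k, 0 ≤ β k) {l : ι → ℝ}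
    (hl : ∀ i, 0 ≤ l i) :
    IsLeast (Set.range (estError σ2 g a β l))
      (σ2 + ∑ k, β k * Complex.normSq (a k) -
        (star (crossCov g a β) ⬝ᵥ (covMatrix σ2 g β l)⁻¹ *ᵥ crossCov g a β).re) := by
  have hA := covMatrix_posDef (g := g) hσ hβ hl
  set A := covMatrix σ2 g β l
  set c := crossCov g a β
  set v := A⁻¹ *ᵥ c with hv
  have hAv : A *ᵥ v = c := by
    rw [hv, Matrix.mulVec_mulVec, Matrix.mul_nonsing_inv _ ((Matrix.isUnit_iff_isUnit_det _).1
      hA.isUnit), Matrix.one_mulVec]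
  have hre (z : ι → ℂ) : (star c ⬝ᵥ z).re = (star z ⬝ᵥ c).re := by
    rw [Matrix.star_dotProduct, Complex.star_def, Complex.conj_re, dotProduct_comm]
  have hvA (x : ι → ℂ) : star v ⬝ᵥ A *ᵥ x = star c ⬝ᵥ x := by
    rw [Matrix.dotProduct_mulVec, ← congrArg star hAv, Matrix.star_mulVec A v, hA.isHermitian.eq]
  have key (z : ι → ℂ) : estError σ2 g a β l z =
      σ2 + ∑ k, β k * Complex.normSq (a k) - (star c ⬝ᵥ v).re +
        (star (z - v) ⬝ᵥ A *ᵥ (z - v)).re := by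
    rw [estError_eq, Matrix.mulVec_sub, hAv, star_sub, sub_dotProduct, dotProduct_sub,
      dotProduct_sub, hvA]
    simp only [Complex.sub_re, hre]
    ring
  refine ⟨⟨v, by rw [key]; simp⟩, ?_⟩
  rintro _ ⟨z, rfl⟩
  rw [key]
  exact le_add_of_nonneg_right (hA.posSemidef.re_dotProduct_nonneg (z - v))

end Estimation

section Recursion

variable {M K : ℕ} {h : Fin M → Fin K → ℂ} {σ2 : ℝ} {C : Fin M → ℝ}

theorem lam_eq (β : Fin K → ℝ) (m : Fin M) :
    lam M K h σ2 C β m =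
      (σ2 + ∑ k, β k * Complex.normSq (h m k) -
        (star (crossCov (fun i : Fin m => h (i.castLE m.isLt.le)) (h m) β) ⬝ᵥ
          (covMatrix σ2 (fun i : Fin m => h (i.castLE m.isLt.le)) β
            fun i => lam M K h σ2 C β (i.castLE m.isLt.le))⁻¹ *ᵥ
          crossCov (fun i : Fin m => h (i.castLE m.isLt.le)) (h m) β).re) /
        ((2 : ℝ) ^ C m - 1) := by
  rw [lam, lamAux]
  unfold leadProd
  congr 3
  have hne (i : Fin m) : Fin.castLE m.isLt.le i ≠ m :=
    (show Fin.castLE m.isLt.le i < m from i.isLt).ne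
  simp only [dotProduct, Matrix.mulVec, mul_sum]
  refine sum_congr rfl fun i _ => sum_congr rfl fun j _ => ?_
  rw [← mul_assoc]
  congr 1
  · congr 1
    · simp [crossCov, (hne i).symm, mul_comm, mul_left_comm, mul_assoc]
    · refine congrFun₂ (congrArg (fun A : Matrix (Fin m) (Fin m) ℂ => A⁻¹)
        (Matrix.ext fun i j => ?_)) i j
      refine (Matrix.submatrix_apply _ _ _ i j).trans ?_
      simp [covMatrix, lam]
  · simp [crossCov, hne j]

theorem two_rpow_sub_one_pos {x : ℝ} (hx : 0 < x) : 0 < (2 : ℝ) ^ x - 1 :=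
  sub_pos.2 (Real.one_lt_rpow one_lt_two hx)

theorem isLeast_lam (hσ : 0 < σ2) (hC : ∀ m, 0 < C m) {β : Fin K → ℝ} (hβ : ∀ k, 0 ≤ β k)
    (m : Fin M) (hl : ∀ i < m, 0 ≤ lam M K h σ2 C β i) :
    IsLeast (Set.range (estError σ2 (fun i : Fin m => h (i.castLE m.isLt.le)) (h m) β
      fun i => lam M K h σ2 C β (i.castLE m.isLt.le)))
      (((2 : ℝ) ^ C m - 1) * lam M K h σ2 C β m) := by
  rw [lam_eq, mul_div_cancel₀ _ (two_rpow_sub_one_pos (hC m)).ne']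
  exact isLeast_estError hσ hβ fun i => hl _ i.isLt

theorem lam_nonneg (hσ : 0 < σ2) (hC : ∀ m, 0 < C m) {β : Fin K → ℝ} (hβ : ∀ k, 0 ≤ β k)
    (m : Fin M) : 0 ≤ lam M K h σ2 C β m := by
  induction m using WellFoundedLT.induction with
  | _ m ih =>
    obtain ⟨z, hz⟩ := (isLeast_lam hσ hC hβ m ih).1
    refine nonneg_of_mul_nonneg_right ?_ (two_rpow_sub_one_pos (hC m))
    rw [← hz]
    exact estError_nonneg hσ.le hβ (fun i => ih _ i.isLt) z

theorem lam_mono (hσ : 0 < σ2) (hC : ∀ m, 0 < C m) {β β' : Fin K → ℝ} (hβ : ∀ k, 0 ≤ β k)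
    (hββ' : ∀ k, β k ≤ β' k) (m : Fin M) :
    lam M K h σ2 C β m ≤ lam M K h σ2 C β' m := by
  have hβ' k := (hβ k).trans (hββ' k)
  induction m using WellFoundedLT.induction with
  | _ m ih =>
    obtain ⟨z, hz⟩ := (isLeast_lam (h := h) hσ hC hβ' m fun i _ => lam_nonneg hσ hC hβ' i).1
    refine le_of_mul_le_mul_left ?_ (two_rpow_sub_one_pos (hC m))
    rw [← hz]
    exact ((isLeast_lam hσ hC hβ m fun i _ => lam_nonneg hσ hC hβ i).2 ⟨z, rfl⟩).trans
      (estError_mono hββ' (fun i => ih _ i.isLt) z)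

theorem lam_smul_le (hσ : 0 < σ2) (hC : ∀ m, 0 < C m) {β : Fin K → ℝ} (hβ : ∀ k, 0 ≤ β k)
    {α : ℝ} (hα : 1 ≤ α) (m : Fin M) :
    lam M K h σ2 C (fun k => α * β k) m ≤ α * lam M K h σ2 C β m := by
  have hβ' k : 0 ≤ α * β k := mul_nonneg (zero_le_one.trans hα) (hβ k)
  induction m using WellFoundedLT.induction with
  | _ m ih =>
    obtain ⟨z, hz⟩ := (isLeast_lam (h := h) hσ hC hβ m fun i _ => lam_nonneg hσ hC hβ i).1
    refine le_of_mul_le_mul_left ?_ (two_rpow_sub_one_pos (hC m))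
    rw [mul_left_comm, ← hz]
    exact ((isLeast_lam hσ hC hβ' m fun i _ => lam_nonneg hσ hC hβ' i).2 ⟨z, rfl⟩).trans
      ((estError_mono (fun _ => le_rfl) (fun i => ih _ i.isLt) z).trans
        (estError_smul_le hσ.le β _ hα z))

end Recursion

/-- **Standard-interference-function property of the dual uplink map with Wyner-Ziv
quantization noises** (Lemma, Appendix G): the map `I` is positive, strictly
sub-homogeneous, and monotone on the nonnegative orthant. -/
theorem interference_function_WZ
    (M K : ℕ) (h : Fin M → Fin K → ℂ) (σ2 : ℝ) (hσ : 0 < σ2)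
    (u : Fin K → Fin M → ℂ)
    (R : Fin K → ℝ) (hR : ∀ k, 0 < R k)
    (hch : ∀ k, dotH (u k) (hvec h k) ≠ 0)
    (C : Fin M → ℝ) (hC : ∀ m, 0 < C m)
    (β : Fin K → ℝ) (hβ : ∀ k, 0 ≤ β k) :
    (∀ k, 0 < Ifun M K h σ2 u R C β k) ∧
    (∀ α : ℝ, 1 < α → ∀ k,
      Ifun M K h σ2 u R C (fun i => α * β i) k < α * Ifun M K h σ2 u R C β k) ∧
    (∀ βbar : Fin K → ℝ, (∀ i, 0 ≤ βbar i) → (∀ i, β i ≤ βbar i) →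
      ∀ k, Ifun M K h σ2 u R C β k ≤ Ifun M K h σ2 u R C βbar k) := by
  have hRpos k := two_rpow_sub_one_pos (hR k)
  have hden k : 0 < Complex.normSq (dotH (u k) (hvec h k)) := Complex.normSq_pos.2 (hch k)
  refine ⟨fun k => ?_, fun α hα k => ?_, fun βbar _ hle k => ?_⟩
  · refine div_pos (mul_pos (hRpos k) ?_) (hden k)
    exact add_pos_of_pos_of_nonneg (add_pos_of_pos_of_nonneg hσ
      (sum_nonneg fun j _ => mul_nonneg (hβ j) (Complex.normSq_nonneg _)))
      (sum_nonneg fun m _ => mul_nonneg (lam_nonneg hσ hC hβ m) (Complex.normSq_nonneg _))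
  · rw [Ifun, Ifun, ← mul_div_assoc, mul_left_comm]
    refine div_lt_div_of_pos_right (mul_lt_mul_of_pos_left ?_ (hRpos k)) (hden k)
    simp only [mul_add, mul_sum]
    refine add_lt_add_of_lt_of_le (add_lt_add_of_lt_of_le (lt_mul_of_one_lt_left hσ hα)
      (sum_le_sum fun j _ => (mul_assoc _ _ _).le)) (sum_le_sum fun m _ => ?_)
    rw [← mul_assoc]
    exact mul_le_mul_of_nonneg_right (lam_smul_le hσ hC hβ hα.le m) (Complex.normSq_nonneg _)
  · refine div_le_div_of_nonneg_right (mul_le_mul_of_nonneg_left ?_ (hRpos k).le) (hden k).le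
    refine add_le_add (add_le_add le_rfl (sum_le_sum fun j _ => ?_)) (sum_le_sum fun m _ => ?_)
    · exact mul_le_mul_of_nonneg_right (hle j) (Complex.normSq_nonneg _)
    · exact mul_le_mul_of_nonneg_right (lam_mono hσ hC hβ hle m) (Complex.normSq_nonneg _)

end Stmt15
end
end

section
/- Rank-one perturbation positive semidefiniteness lemma (Lemma 7, Appendix D): Let M ≥ 2, let a ∈ ℂ^M with first entry a^{(1)} real and a^{(1)} > 0, and let B ∈ ℂ^{(M−1)×(M−1)} be Hermitian. If the M×M matrix a a^H + blkdiag(0, B) is positive semidefinite, where blkdiag(0, B) has a single 0 in the (1,1) entry, B in the lower-right (M−1)×(M−1) block, and zeros elsewhere, then B is positive semidefinite. -/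
open Matrix
open scoped ComplexOrder

noncomputable section

namespace Stmt16

/-- `blkdiag(0, B)`: the `M × M` matrix with a single `0` in the `(1,1)` entry,
`B` in the lower-right `(M−1) × (M−1)` block, and zeros elsewhere. -/
def pad {M : ℕ} (B : Matrix (Fin (M - 1)) (Fin (M - 1)) ℂ) :
    Matrix (Fin M) (Fin M) ℂ :=
  fun i j =>
    if hij : 0 < i.val ∧ 0 < j.val then
      B ⟨i.val - 1, by have := i.isLt; omega⟩ ⟨j.val - 1, by have := j.isLt; omega⟩
    else 0

/-- rank-one matrix `a a^H`. -/
def outerSelf {M : ℕ} (a : Fin M → ℂ) : Matrix (Fin M) (Fin M) ℂ :=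
  Matrix.vecMulVec a fun j => (starRingEnd ℂ) (a j)

lemma pad_mulVec_cons {n : ℕ} (B : Matrix (Fin n) (Fin n) ℂ) (c : ℂ) (y : Fin n → ℂ) :
    pad (M := n + 1) B *ᵥ (Fin.cons c y : Fin (n + 1) → ℂ) =
      (Fin.cons 0 (B *ᵥ y) : Fin (n + 1) → ℂ) := by
  ext i
  refine Fin.cases ?_ (fun i => ?_) i <;>
    simp [pad, Matrix.mulVec, dotProduct, Fin.sum_univ_succ]

lemma outerSelf_mulVec_eq_zero {M : ℕ} (a x : Fin M → ℂ) (h : star a ⬝ᵥ x = 0) :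
    outerSelf a *ᵥ x = 0 := by
  have h' : (fun j => (starRingEnd ℂ) (a j)) ⬝ᵥ x = 0 := h
  simp [outerSelf, Matrix.vecMulVec_mulVec, h']

/-- **Lemma 7** (rank-one perturbation positive semidefiniteness): if `a^{(1)}` is real
and positive, `B` is Hermitian, and `a a^H + blkdiag(0, B)` is positive semidefinite,
then `B` is positive semidefinite. -/
theorem rank_one_perturbation_psd
    (M : ℕ) (hM : 2 ≤ M) (a : Fin M → ℂ)
    (ha_im : (a ⟨0, by omega⟩).im = 0) (ha_re : 0 < (a ⟨0, by omega⟩).re)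
    (B : Matrix (Fin (M - 1)) (Fin (M - 1)) ℂ) (hB : B.IsHermitian)
    (hpsd : (outerSelf a + pad B).PosSemidef) :
    B.PosSemidef := by
  obtain ⟨n, rfl⟩ : ∃ n, M = n + 1 := ⟨M - 1, by omega⟩
  have ha : a 0 ≠ 0 := fun h => by
    have h' : 0 < (a 0).re := ha_re
    simp [h] at h'
  change Matrix (Fin n) (Fin n) ℂ at B
  refine Matrix.posSemidef_iff_dotProduct_mulVec.mpr ⟨hB, fun y => ?_⟩
  change Fin n → ℂ at y
  let c : ℂ := -(∑ i : Fin n, star (a i.succ) * y i) / star (a 0)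
  have horth : star a ⬝ᵥ (Fin.cons c y : Fin (n + 1) → ℂ) = 0 := by
    have h0 : star (a 0) ≠ 0 := star_ne_zero.mpr ha
    simp only [dotProduct, Fin.sum_univ_succ, Fin.cons_zero, Fin.cons_succ, Pi.star_apply, c]
    rw [mul_div_cancel₀ _ h0]
    ring
  have hx := (Matrix.posSemidef_iff_dotProduct_mulVec.mp hpsd).2 (Fin.cons c y)
  rw [Matrix.add_mulVec, outerSelf_mulVec_eq_zero a _ horth, zero_add, pad_mulVec_cons] at hx
  simpa [dotProduct, Fin.sum_univ_succ] using hx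

end Stmt16
end
end

section
/- Quotient property of Schur complements along the recursion (Lemma 2, Appendix D): Suppose Hermitian positive definite matrices A_1 ∈ ℂ^{M×M}, A_2 ∈ ℂ^{(M−1)×(M−1)}, …, A_M ∈ ℂ^{1×1} satisfy the recursion A_m = A_{m−1}^{(2:M−m+2,2:M−m+2)} − A_{m−1}^{(2:M−m+2,1)} A_{m−1}^{(1,2:M−m+2)} / A_{m−1}^{(1,1)} for m = 2,…,M. For a Hermitian positive definite matrix X and index j ≥ 1, write S_j(X) = X^{(j,j)} − X^{(j,1:j−1)}(X^{(1:j−1,1:j−1)})^{−1}X^{(1:j−1,j)}, with S_1(X) = X^{(1,1)}. Then for every m ∈ {2,…,M} and every n ∈ {2,…,m}: S_{m−n+1}(A_n) = S_{m−n+2}(A_{n−1}). In particular, S_1(A_m) = S_m(A_1) for every m. -/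
open Matrix
open scoped ComplexOrder

noncomputable section

namespace Stmt17

/-- `X^{(m,1:m-1)} (X^{(1:m-1,1:m-1)})⁻¹ X^{(1:m-1,m)}` (equal to `0` for the first index). -/
def leadProd {n : ℕ} (X : Matrix (Fin n) (Fin n) ℂ) (m : Fin n) : ℂ :=
  ∑ i : Fin m.val, ∑ j : Fin m.val,
    X m (Fin.castLE m.isLt.le i) *
      (X.submatrix (Fin.castLE m.isLt.le) (Fin.castLE m.isLt.le))⁻¹ i j *
      X (Fin.castLE m.isLt.le j) m

/-- the Schur complement `S_j(X) = X^{(j,j)} − X^{(j,1:j−1)}(X^{(1:j−1,1:j−1)})⁻¹X^{(1:j−1,j)}`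
(0-indexed position `j`; for the first index it is just the `(1,1)` entry). -/
def schurLead {n : ℕ} (X : Matrix (Fin n) (Fin n) ℂ) (m : Fin n) : ℂ :=
  X m m - leadProd X m

lemma auxlt {M mv iv : ℕ} (hm : 0 < mv) (hi : iv < M - mv) : iv + 1 < M - (mv - 1) := by
  omega

lemma auxzero {M mv : ℕ} (hmM : mv < M) : 0 < M - (mv - 1) := by omega

lemma auxm1 {M mv : ℕ} (hmM : mv < M) : mv - 1 < M := by omega

lemma qa {M mi ni : ℕ} (h2 : ni ≤ mi) (h3 : mi ≤ M - 1) (hM : 0 < M) : ni < M := by omega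

lemma qb {M mi ni : ℕ} (h2 : ni ≤ mi) (h3 : mi ≤ M - 1) (hM : 0 < M) :
    mi - ni < M - ni := by omega

lemma qc {M ni : ℕ} (h : ni < M) : ni - 1 < M := by omega

lemma qd {M mi ni : ℕ} (h1 : 1 ≤ ni) (h2 : ni ≤ mi) (h3 : mi ≤ M - 1) (hM : 0 < M) :
    mi - ni + 1 < M - (ni - 1) := by omega

lemma qe {M mi : ℕ} (h3 : mi ≤ M - 1) (hM : 0 < M) : mi < M := by omega

lemma qf {M mi : ℕ} (h : mi < M) : 0 < M - mi := by omega

lemma qg {M mi : ℕ} (h : mi < M) : mi < M - 0 := by omega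

/-- The recursion `A_m = A_{m−1}^{(2:,2:)} − A_{m−1}^{(2:,1)} A_{m−1}^{(1,2:)} / A_{m−1}^{(1,1)}`
(0-indexed: `A ⟨n⟩` is the paper's `A_{n+1} ∈ ℂ^{(M−n)×(M−n)}`). -/
def SchurRec (M : ℕ)
    (A : (m : Fin M) → Matrix (Fin (M - m.val)) (Fin (M - m.val)) ℂ) : Prop :=
  ∀ (m : Fin M) (hm : 0 < m.val) (i j : Fin (M - m.val)),
    A m i j =
      A ⟨m.val - 1, auxm1 m.isLt⟩
          ((⟨i.val + 1, auxlt hm i.isLt⟩ : Fin (M - (m.val - 1))) :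
            Fin (M - (m.val - 1)))
          ((⟨j.val + 1, auxlt hm j.isLt⟩ : Fin (M - (m.val - 1))) :
            Fin (M - (m.val - 1))) -
        A ⟨m.val - 1, auxm1 m.isLt⟩
            ((⟨i.val + 1, auxlt hm i.isLt⟩ : Fin (M - (m.val - 1))) :
              Fin (M - (m.val - 1)))
            ((⟨0, auxzero m.isLt⟩ : Fin (M - (m.val - 1))) : Fin (M - (m.val - 1))) *
          A ⟨m.val - 1, auxm1 m.isLt⟩
              ((⟨0, auxzero m.isLt⟩ : Fin (M - (m.val - 1))) : Fin (M - (m.val - 1)))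
              ((⟨j.val + 1, auxlt hm j.isLt⟩ : Fin (M - (m.val - 1))) :
                Fin (M - (m.val - 1))) /
          A ⟨m.val - 1, auxm1 m.isLt⟩
              ((⟨0, auxzero m.isLt⟩ : Fin (M - (m.val - 1))) : Fin (M - (m.val - 1)))
              ((⟨0, auxzero m.isLt⟩ : Fin (M - (m.val - 1))) : Fin (M - (m.val - 1)))

/-- The quotient identity `S_{m−n+1}(A_n) = S_{m−n+2}(A_{n−1})` for `2 ≤ n ≤ m ≤ M`
(stated 0-indexed: `ni = n − 1`, `mi = m − 1`). -/
def QuotientId (M : ℕ)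
    (A : (m : Fin M) → Matrix (Fin (M - m.val)) (Fin (M - m.val)) ℂ) : Prop :=
  ∀ (mi ni : ℕ) (h1 : 1 ≤ ni) (h2 : ni ≤ mi) (h3 : mi ≤ M - 1) (hM : 0 < M),
    schurLead (A ⟨ni, qa h2 h3 hM⟩)
        ((⟨mi - ni, qb h2 h3 hM⟩ : Fin (M - ni)) : Fin (M - ni)) =
      schurLead (A ⟨ni - 1, qc (qa h2 h3 hM)⟩)
        ((⟨mi - ni + 1, qd h1 h2 h3 hM⟩ : Fin (M - (ni - 1))) : Fin (M - (ni - 1)))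

/-- The particular case `S_1(A_m) = S_m(A_1)` for `1 ≤ m ≤ M` (0-indexed `mi = m − 1`). -/
def QuotientIdCorner (M : ℕ)
    (A : (m : Fin M) → Matrix (Fin (M - m.val)) (Fin (M - m.val)) ℂ) : Prop :=
  ∀ (mi : ℕ) (h3 : mi ≤ M - 1) (hM : 0 < M),
    schurLead (A ⟨mi, qe h3 hM⟩)
        ((⟨0, qf (qe h3 hM)⟩ : Fin (M - mi)) : Fin (M - mi)) =
      schurLead (A ⟨0, hM⟩)
        ((⟨mi, qg (qe h3 hM)⟩ : Fin (M - 0)) : Fin (M - 0))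

/-- The leading principal minor of size `k`. -/
def leadMinor {n : ℕ} (X : Matrix (Fin n) (Fin n) ℂ) (k : ℕ) (hk : k ≤ n) : ℂ :=
  (X.submatrix (Fin.castLE hk) (Fin.castLE hk)).det

lemma leadMinor_ne_zero {n : ℕ} {X : Matrix (Fin n) (Fin n) ℂ} (hX : X.PosDef) (k : ℕ)
    (hk : k ≤ n) : leadMinor X k hk ≠ 0 :=
  ((Matrix.isUnit_iff_isUnit_det _).1
    (hX.submatrix (Fin.castLE_injective hk)).isUnit).ne_zero

lemma leadMinor_succ {n : ℕ} {X : Matrix (Fin n) (Fin n) ℂ} (hX : X.PosDef) (m : Fin n) :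
    leadMinor X (m.val + 1) m.isLt = leadMinor X m.val m.isLt.le * schurLead X m := by
  set T := X.submatrix (Fin.castLE m.isLt.le) (Fin.castLE m.isLt.le)
  have hTu : IsUnit T := (hX.submatrix (Fin.castLE_injective m.isLt.le)).isUnit
  let := hTu.invertible
  have hle : m.val + 1 ≤ n := m.isLt
  have hblocks : (X.submatrix (Fin.castLE hle) (Fin.castLE hle)).submatrix
      (finSumFinEquiv (m := m.val) (n := 1)) finSumFinEquiv =
      fromBlocks T (Matrix.of fun i _ => X (Fin.castLE m.isLt.le i) m)
        (Matrix.of fun _ j => X m (Fin.castLE m.isLt.le j)) (Matrix.of fun _ _ => X m m) := by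
    have hlast (j : Fin 1) :
        Fin.castLE hle (Fin.natAdd m.val j) = m := by
      ext
      simp
    ext (i | i) (j | j)
    · rfl
    · exact congrArg (X _) (hlast j)
    · exact congrArg (X · _) (hlast i)
    · exact congrArg₂ X (hlast i) (hlast j)
  rw [leadMinor, leadMinor, ← det_submatrix_equiv_self (finSumFinEquiv (m := m.val) (n := 1)),
    hblocks, det_fromBlocks₁₁, det_fin_one, invOf_eq_nonsing_inv, schurLead, leadProd]
  congr 1
  rw [Matrix.sub_apply, mul_apply]
  simp only [mul_apply, of_apply, Finset.sum_mul]
  rw [Finset.sum_comm]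

/-- Gaussian elimination of the first column. -/
lemma det_eq_mul_det_schur_zero {k : ℕ} (Z : Matrix (Fin (k + 1)) (Fin (k + 1)) ℂ)
    (hZ : Z 0 0 ≠ 0) :
    Z.det = Z 0 0 *
      (Matrix.of fun i j : Fin k => Z i.succ j.succ - Z i.succ 0 * Z 0 j.succ / Z 0 0).det := by
  let c : Fin (k + 1) → ℂ := Fin.cons 0 fun i => Z i.succ 0 / Z 0 0
  let B : Matrix (Fin (k + 1)) (Fin (k + 1)) ℂ := Matrix.of fun i j => Z i j - c i * Z 0 j
  have hc : c 0 = 0 := rfl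
  have hcs (i : Fin k) : c i.succ = Z i.succ 0 / Z 0 0 := rfl
  have hdet : Z.det = B.det :=
    det_eq_of_forall_row_eq_smul_add_const c 0 hc fun i j => by simp [B, hc]
  rw [hdet, det_succ_column_zero, Fin.sum_univ_succ, Finset.sum_eq_zero]
  · have hsub : B.submatrix (Fin.succAbove 0) Fin.succ =
        Matrix.of fun i j : Fin k => Z i.succ j.succ - Z i.succ 0 * Z 0 j.succ / Z 0 0 := by
      ext i j
      simp only [submatrix_apply, Fin.zero_succAbove, B, of_apply, hcs]
      ring
    rw [hsub]
    simp [B, hc]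
  · intro i _
    simp [B, hcs, hZ]

lemma leadMinor_succ_eq_mul {n p : ℕ} (hnp : n = p + 1) {X : Matrix (Fin n) (Fin n) ℂ}
    {Y : Matrix (Fin p) (Fin p) ℂ} (h0 : 0 < n) (hX : X ⟨0, h0⟩ ⟨0, h0⟩ ≠ 0)
    (hs : ∀ i : Fin p, i.val + 1 < n)
    (hY : ∀ i j, Y i j = X ⟨i.val + 1, hs i⟩ ⟨j.val + 1, hs j⟩ -
      X ⟨i.val + 1, hs i⟩ ⟨0, h0⟩ * X ⟨0, h0⟩ ⟨j.val + 1, hs j⟩ / X ⟨0, h0⟩ ⟨0, h0⟩)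
    (k : ℕ) (hk : k ≤ p) (hk' : k + 1 ≤ n) :
    leadMinor X (k + 1) hk' = X ⟨0, h0⟩ ⟨0, h0⟩ * leadMinor Y k hk := by
  subst hnp
  refine (det_eq_mul_det_schur_zero (X.submatrix (Fin.castLE hk') (Fin.castLE hk')) hX).trans ?_
  refine congrArg (fun W : Matrix (Fin k) (Fin k) ℂ => X ⟨0, h0⟩ ⟨0, h0⟩ * W.det) ?_
  ext i j
  exact (hY (Fin.castLE hk i) (Fin.castLE hk j)).symm

lemma schurLead_eq_schurLead_succ {n p : ℕ} (hnp : n = p + 1) {X : Matrix (Fin n) (Fin n) ℂ}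
    {Y : Matrix (Fin p) (Fin p) ℂ} (hX : X.PosDef) (hYpos : Y.PosDef) (h0 : 0 < n)
    (hs : ∀ i : Fin p, i.val + 1 < n)
    (hY : ∀ i j, Y i j = X ⟨i.val + 1, hs i⟩ ⟨j.val + 1, hs j⟩ -
      X ⟨i.val + 1, hs i⟩ ⟨0, h0⟩ * X ⟨0, h0⟩ ⟨j.val + 1, hs j⟩ / X ⟨0, h0⟩ ⟨0, h0⟩)
    (k : ℕ) (hk : k < p) (hk' : k + 1 < n) :
    schurLead Y ⟨k, hk⟩ = schurLead X ⟨k + 1, hk'⟩ := by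
  have hX0 : X ⟨0, h0⟩ ⟨0, h0⟩ ≠ 0 := hX.diag_pos.ne'
  have hXs := leadMinor_succ hX ⟨k + 1, hk'⟩
  have hYs := leadMinor_succ hYpos ⟨k, hk⟩
  have hq := leadMinor_succ_eq_mul hnp h0 hX0 hs hY k hk.le hk'.le
  have hqs := leadMinor_succ_eq_mul hnp h0 hX0 hs hY (k + 1) hk hk'
  refine mul_left_cancel₀ (mul_ne_zero hX0 (leadMinor_ne_zero hYpos k hk.le)) ?_
  calc _ = X ⟨0, h0⟩ ⟨0, h0⟩ * leadMinor Y (k + 1) hk := by rw [mul_assoc, ← hYs]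
    _ = _ := by rw [← hqs, ← hq]; exact hXs

/-- **Lemma 2** (quotient property of Schur complements along the recursion): if each
`A_n` is Hermitian positive definite and they satisfy the recursion `SchurRec`, then
`S_{m−n+1}(A_n) = S_{m−n+2}(A_{n−1})` for all `2 ≤ n ≤ m ≤ M`; in particular
`S_1(A_m) = S_m(A_1)` for every `m`. -/
theorem schur_quotient_property
    (M : ℕ) (hM : 0 < M)
    (A : (m : Fin M) → Matrix (Fin (M - m.val)) (Fin (M - m.val)) ℂ)
    (hposdef : ∀ m, (A m).PosDef)
    (hrec : SchurRec M A) :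
    QuotientId M A ∧ QuotientIdCorner M A := by
  have hquot : QuotientId M A := by
    intro mi ni h1 h2 h3 hM
    exact schurLead_eq_schurLead_succ (show M - (ni - 1) = M - ni + 1 by omega)
      (hposdef ⟨ni - 1, by omega⟩) (hposdef ⟨ni, by omega⟩) (by omega)
      (fun i => auxlt h1 i.isLt) (hrec ⟨ni, qa h2 h3 hM⟩ h1) (mi - ni) _ _
  refine ⟨hquot, fun mi h3 hM => ?_⟩
  have hchain : ∀ (ni : ℕ) (h2 : ni ≤ mi), schurLead (A ⟨ni, qa h2 h3 hM⟩)
      ⟨mi - ni, qb h2 h3 hM⟩ = schurLead (A ⟨0, hM⟩) ⟨mi, qg (qe h3 hM)⟩ := by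
    intro ni
    induction ni with
    | zero => exact fun _ => rfl
    | succ ni ih =>
      intro h2
      rw [hquot mi (ni + 1) (by omega) h2 h3 hM, ← ih (by omega)]
      congr 2
      omega
  rw [← hchain mi le_rfl]
  congr 2
  omega

end Stmt17
end
end

section
/- Properties of the recursively defined uplink quantization-noise map (Lemma 5, Appendix G): For β ∈ ℝ_{≥0}^K define λ(β) ∈ ℝ^M recursively by λ_1(β) = (σ² + Σ_{k=1}^K β_k|h_{1,k}|²)/(2^{C_1}−1) and, for m = 2,…,M, λ_m(β) = (σ² + Σ_{k=1}^K β_k|h_{m,k}|² − Ω^{(m,1:m−1)}(Ω^{(1:m−1,1:m−1)})^{−1}Ω^{(1:m−1,m)})/(2^{C_m}−1), where Ω = σ²I + Σ_{k=1}^K β_k h_k h_k^H + diag(λ_1(β),…,λ_M(β)) (only λ_1(β),…,λ_{m−1}(β) appear in the m-th equation, so λ is well defined). Assume σ² > 0 and C_m > 0 for all m. Then for all β ∈ ℝ_{≥0}^K: (1) λ_m(β) > 0 for every m; (2) for every α > 1, λ_m(αβ) < α·λ_m(β) for every m; (3) if β̄ ∈ ℝ_{≥0}^K satisfies β̄ ≥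 β componentwise, then λ_m(β̄) ≥ λ_m(β) for every m. -/
open Finset Matrix

noncomputable section

namespace Stmt19

/-- `X^{(m,1:m-1)} (X^{(1:m-1,1:m-1)})⁻¹ X^{(1:m-1,m)}` (equal to `0` for the first index). -/
def leadProd {n : ℕ} (X : Matrix (Fin n) (Fin n) ℂ) (m : Fin n) : ℂ :=
  ∑ i : Fin m.val, ∑ j : Fin m.val,
    X m (Fin.castLE m.isLt.le i) *
      (X.submatrix (Fin.castLE m.isLt.le) (Fin.castLE m.isLt.le))⁻¹ i j *
      X (Fin.castLE m.isLt.le j) m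

/-- The recursively defined uplink quantization-noise map:
`λ_m(β) = (σ² + Σ_k β_k|h_{m,k}|² − Ω^{(m,1:m−1)}(Ω^{(1:m−1,1:m−1)})⁻¹Ω^{(1:m−1,m)})/(2^{C_m}−1)`
where `Ω = σ²I + Σ_k β_k h_k h_k^H + diag(λ(β))`.  (The recursion is well defined since
only `λ_1(β), …, λ_{m−1}(β)` enter the `m`-th equation; the diagonal entries of the
matrix used below at positions `≥ m` are never read by `leadProd` at `m`.) -/
def lamAux (M K : ℕ) (h : Fin M → Fin K → ℂ) (σ2 : ℝ) (C : Fin M → ℝ)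
    (β : Fin K → ℝ) : (m : ℕ) → m < M → ℝ
  | m, hm =>
    (σ2 + ∑ k, β k * Complex.normSq (h ⟨m, hm⟩ k) -
      (leadProd (fun i j : Fin M =>
        (∑ k, (β k : ℂ) * h i k * (starRingEnd ℂ) (h j k)) +
        (if i = j then
          (if hi : i.val < m then
            ((σ2 + lamAux M K h σ2 C β i.val (hi.trans hm) : ℝ) : ℂ)
           else ((σ2 : ℝ) : ℂ))
         else 0)) ⟨m, hm⟩).re) / ((2:ℝ) ^ (C ⟨m, hm⟩) - 1)
  termination_by m _ => m

/-- `λ(β)` as a vector indexed by `Fin M`. -/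
def lam (M K : ℕ) (h : Fin M → Fin K → ℂ) (σ2 : ℝ) (C : Fin M → ℝ)
    (β : Fin K → ℝ) (m : Fin M) : ℝ :=
  lamAux M K h σ2 C β m.val m.isLt

/-- The quadratic form whose minimum over `v` is a Schur complement
of `H diag(β) Hᴴ + diag(d)` bordered by the row `star p`. -/
def borderedForm {n K : ℕ} (H : Matrix (Fin n) (Fin K) ℂ) (p : Fin K → ℂ)
    (d : Fin n → ℝ) (β : Fin K → ℝ) (v : Fin n → ℂ) : ℝ :=
  ∑ i, d i * Complex.normSq (v i) + ∑ k, β k * Complex.normSq (p k + (Hᴴ *ᵥ v) k)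

/-- The Gram matrix `H diag(β) Hᴴ + diag(d)`. -/
def loadedGram {n K : ℕ} (H : Matrix (Fin n) (Fin K) ℂ)
    (d : Fin n → ℝ) (β : Fin K → ℝ) : Matrix (Fin n) (Fin n) ℂ :=
  H * diagonal (fun k => (β k : ℂ)) * Hᴴ + diagonal (fun i => (d i : ℂ))

lemma star_dotProduct_diagonal_mulVec {n : ℕ} (d : Fin n → ℝ) (v : Fin n → ℂ) :
    star v ⬝ᵥ (diagonal (fun i => (d i : ℂ)) *ᵥ v) =
      ((∑ i, d i * Complex.normSq (v i) : ℝ) : ℂ) := by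
  simp only [dotProduct, mulVec_diagonal, Pi.star_apply, Complex.ofReal_sum, Complex.ofReal_mul,
    Complex.normSq_eq_conj_mul_self, RCLike.star_def]
  exact Finset.sum_congr rfl fun i _ => by ring

open scoped ComplexOrder in
lemma loadedGram_posDef {n K : ℕ} (H : Matrix (Fin n) (Fin K) ℂ)
    {d : Fin n → ℝ} {β : Fin K → ℝ} (hd : ∀ i, 0 < d i) (hβ : ∀ k, 0 ≤ β k) :
    (loadedGram H d β).PosDef := by
  refine PosDef.posSemidef_add ?_ ?_
  · refine PosSemidef.mul_mul_conjTranspose_same ?_ H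
    exact posSemidef_diagonal_iff.2 fun k => by exact_mod_cast hβ k
  · exact posDef_diagonal_iff.2 fun i => by exact_mod_cast hd i

lemma ofReal_borderedForm {n K : ℕ} (H : Matrix (Fin n) (Fin K) ℂ) (p : Fin K → ℂ)
    (d : Fin n → ℝ) (β : Fin K → ℝ) (v : Fin n → ℂ) :
    (borderedForm H p d β v : ℂ) =
      star p ⬝ᵥ (diagonal (fun k => (β k : ℂ)) *ᵥ p) +
      star v ⬝ᵥ (H *ᵥ (diagonal (fun k => (β k : ℂ)) *ᵥ p)) +
      star (H *ᵥ (diagonal (fun k => (β k : ℂ)) *ᵥ p)) ⬝ᵥ v +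
      star v ⬝ᵥ (loadedGram H d β *ᵥ v) := by
  have hB : (diagonal (fun k => (β k : ℂ)))ᴴ = diagonal (fun k => (β k : ℂ)) := by
    rw [diagonal_conjTranspose]
    congr 1
    ext k
    simp
  have hy := star_dotProduct_diagonal_mulVec β (p + Hᴴ *ᵥ v)
  have hv := star_dotProduct_diagonal_mulVec d v
  simp only [Pi.add_apply] at hy
  rw [borderedForm, Complex.ofReal_add, ← hv, ← hy, loadedGram]
  simp only [star_add, add_dotProduct, mulVec_add, dotProduct_add, add_mulVec, star_mulVec,
    conjTranspose_conjTranspose, hB, ← mulVec_mulVec, dotProduct_mulVec,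
    add_vecMul]
  ring

open scoped ComplexOrder in
lemma borderedForm_eq_schur_add {n K : ℕ} (H : Matrix (Fin n) (Fin K) ℂ) (p : Fin K → ℂ)
    {d : Fin n → ℝ} {β : Fin K → ℝ} (hd : ∀ i, 0 < d i) (hβ : ∀ k, 0 ≤ β k)
    {b u : Fin n → ℂ} (hb : b = H *ᵥ (diagonal (fun k => (β k : ℂ)) *ᵥ p))
    (hu : u = (loadedGram H d β)⁻¹ *ᵥ b) (v : Fin n → ℂ) :
    borderedForm H p d β v =
      (∑ k, β k * Complex.normSq (p k) - (star b ⬝ᵥ u).re) +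
      (star (v + u) ⬝ᵥ (loadedGram H d β *ᵥ (v + u))).re := by
  have hA := loadedGram_posDef H hd hβ
  have hAu : loadedGram H d β *ᵥ u = b := by
    rw [hu, mulVec_mulVec, mul_nonsing_inv _ ((isUnit_iff_isUnit_det (A := loadedGram H d β)).1 hA.isUnit), one_mulVec]
  have huA : star u ᵥ* loadedGram H d β = star b := by
    rw [← hAu, star_mulVec, hA.isHermitian.eq]
  have hub : (star b ⬝ᵥ u) = star u ⬝ᵥ b := by
    rw [← huA, ← dotProduct_mulVec, hAu]
  have key : (borderedForm H p d β v : ℂ) =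
      ((∑ k, β k * Complex.normSq (p k) : ℝ) : ℂ) - star b ⬝ᵥ u +
      star (v + u) ⬝ᵥ (loadedGram H d β *ᵥ (v + u)) := by
    rw [ofReal_borderedForm, star_dotProduct_diagonal_mulVec, ← hb]
    have h1 : star u ⬝ᵥ (loadedGram H d β *ᵥ v) = star b ⬝ᵥ v := by
      rw [dotProduct_mulVec, huA]
    simp only [star_add, add_dotProduct, mulVec_add, dotProduct_add, hAu, h1, hub]
    ring
  have := congrArg Complex.re key
  simpa only [Complex.add_re, Complex.sub_re, Complex.ofReal_re] using this

open scoped ComplexOrder in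
lemma isLeast_borderedForm {n K : ℕ} (H : Matrix (Fin n) (Fin K) ℂ) (p : Fin K → ℂ)
    {d : Fin n → ℝ} {β : Fin K → ℝ} (hd : ∀ i, 0 < d i) (hβ : ∀ k, 0 ≤ β k)
    {b : Fin n → ℂ} (hb : b = H *ᵥ (diagonal (fun k => (β k : ℂ)) *ᵥ p)) :
    IsLeast (Set.range (borderedForm H p d β))
      (∑ k, β k * Complex.normSq (p k) -
        (star b ⬝ᵥ ((loadedGram H d β)⁻¹ *ᵥ b)).re) := by
  constructor
  · refine ⟨-((loadedGram H d β)⁻¹ *ᵥ b), ?_⟩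
    rw [borderedForm_eq_schur_add H p hd hβ hb rfl]
    simp
  · rintro _ ⟨v, rfl⟩
    rw [borderedForm_eq_schur_add H p hd hβ hb rfl v]
    exact le_add_of_nonneg_right
      ((loadedGram_posDef H hd hβ).posSemidef.re_dotProduct_nonneg _)

/-- The form minimised by the `m`-th component of `lam`. -/
def lamForm {M K : ℕ} (h : Fin M → Fin K → ℂ) (σ2 : ℝ) (C : Fin M → ℝ)
    (β : Fin K → ℝ) (m : Fin M) : (Fin m.val → ℂ) → ℝ :=
  borderedForm (of fun i k => h (Fin.castLE m.isLt.le i) k) (star (h m))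
    (fun i => σ2 + lam M K h σ2 C β (Fin.castLE m.isLt.le i)) β

lemma leadProd_eq_star_dotProduct {n : ℕ} {X : Matrix (Fin n) (Fin n) ℂ} {m : Fin n}
    {A : Matrix (Fin m.val) (Fin m.val) ℂ} {b : Fin m.val → ℂ}
    (hA : X.submatrix (Fin.castLE m.isLt.le) (Fin.castLE m.isLt.le) = A)
    (hcol : ∀ i, X (Fin.castLE m.isLt.le i) m = b i)
    (hrow : ∀ i, X m (Fin.castLE m.isLt.le i) = star (b i)) :
    leadProd X m = star b ⬝ᵥ (A⁻¹ *ᵥ b) := by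
  simp only [leadProd, hA, hcol, hrow, dotProduct, mulVec, Finset.mul_sum, mul_assoc,
    Pi.star_apply]

/-- The covariance matrix `Ω`, with the entries of `lam` included on the diagonal before `m`. -/
def lamGram {M K : ℕ} (h : Fin M → Fin K → ℂ) (σ2 : ℝ) (C : Fin M → ℝ)
    (β : Fin K → ℝ) (m : Fin M) : Matrix (Fin M) (Fin M) ℂ :=
  of fun i j => (∑ k, (β k : ℂ) * h i k * (starRingEnd ℂ) (h j k)) +
    if i = j then if i < m then ((σ2 + lam M K h σ2 C β i : ℝ) : ℂ) else (σ2 : ℂ) else 0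

lemma lam_eq_div {M K : ℕ} (h : Fin M → Fin K → ℂ) (σ2 : ℝ) (C : Fin M → ℝ)
    (β : Fin K → ℝ) (m : Fin M) :
    lam M K h σ2 C β m = (σ2 + ∑ k, β k * Complex.normSq (h m k) -
      (leadProd (lamGram h σ2 C β m) m).re) / ((2 : ℝ) ^ C m - 1) := by
  rw [lam, lamAux]
  rfl

lemma isLeast_lamForm {M K : ℕ} (h : Fin M → Fin K → ℂ) {σ2 : ℝ} (hσ : 0 < σ2)
    {C : Fin M → ℝ} (hC : ∀ m, 0 < C m) {β : Fin K → ℝ} (hβ : ∀ k, 0 ≤ β k) (m : Fin M)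
    (hpos : ∀ i < m, 0 < lam M K h σ2 C β i) :
    IsLeast (Set.range (lamForm h σ2 C β m))
      (lam M K h σ2 C β m * ((2 : ℝ) ^ C m - 1) - σ2) := by
  have hC' : (2 : ℝ) ^ C m - 1 ≠ 0 :=
    (sub_pos.2 (Real.one_lt_rpow one_lt_two (hC m))).ne'
  have hd : ∀ i : Fin m.val, 0 < σ2 + lam M K h σ2 C β (Fin.castLE m.isLt.le i) :=
    fun i => add_pos hσ (hpos _ i.isLt)
  have hne : ∀ i : Fin m.val, Fin.castLE m.isLt.le i ≠ m := fun i hi =>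
    i.isLt.ne (congrArg Fin.val hi)
  have hcol : ∀ i : Fin m.val, ((of fun i k => h (Fin.castLE m.isLt.le i) k) *ᵥ
      (diagonal (fun k => (β k : ℂ)) *ᵥ star (h m))) i =
      ∑ k, h (Fin.castLE m.isLt.le i) k * ((β k : ℂ) * star (h m k)) := by
    intro i
    rw [mulVec, dotProduct]
    exact Finset.sum_congr rfl fun k _ => by rw [mulVec_diagonal, of_apply, Pi.star_apply]
  have hnormSq : ∀ k, Complex.normSq (star (h m) k) = Complex.normSq (h m k) := fun k =>
    Complex.normSq_conj _
  refine Eq.subst (motive := IsLeast _) ?_ (isLeast_borderedForm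
    (of fun i k => h (Fin.castLE m.isLt.le i) k) (star (h m)) hd hβ rfl)
  rw [lam_eq_div, div_mul_cancel₀ _ hC', leadProd_eq_star_dotProduct
      (A := loadedGram (of fun i k => h (Fin.castLE m.isLt.le i) k)
        (fun i => σ2 + lam M K h σ2 C β (Fin.castLE m.isLt.le i)) β)
      (b := (of fun i k => h (Fin.castLE m.isLt.le i) k) *ᵥ
        (diagonal (fun k => (β k : ℂ)) *ᵥ star (h m)))]
  · simp only [hnormSq]
    ring
  · ext i j
    rw [loadedGram, Matrix.add_apply, Matrix.mul_apply, diagonal_apply,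
      submatrix_apply, lamGram, of_apply]
    refine congrArg₂ (· + ·) (Finset.sum_congr rfl fun k _ => ?_) ?_
    · rw [mul_diagonal, conjTranspose_apply, RCLike.star_def, of_apply, of_apply]
      ring
    · simp [Fin.lt_def]
  · intro i
    simp only [hcol, lamGram, of_apply, RCLike.star_def,
      if_neg (hne i), add_zero]
    exact Finset.sum_congr rfl fun k _ => by ring
  · intro i
    simp only [hcol, lamGram, of_apply, RCLike.star_def,
      if_neg (hne i).symm, add_zero, map_sum, map_mul, Complex.conj_conj,
      Complex.conj_ofReal]
    exact Finset.sum_congr rfl fun k _ => by ring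

lemma lam_pos {M K : ℕ} (h : Fin M → Fin K → ℂ) {σ2 : ℝ} (hσ : 0 < σ2)
    {C : Fin M → ℝ} (hC : ∀ m, 0 < C m) {β : Fin K → ℝ} (hβ : ∀ k, 0 ≤ β k) (m : Fin M) :
    0 < lam M K h σ2 C β m := by
  induction m using WellFoundedLT.induction with
  | ind m ih =>
    obtain ⟨v, hv⟩ := (isLeast_lamForm h hσ hC hβ m ih).1
    have hC' : 0 < (2 : ℝ) ^ C m - 1 := sub_pos.2 (Real.one_lt_rpow one_lt_two (hC m))
    have hQ : 0 ≤ lamForm h σ2 C β m v :=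
      add_nonneg
        (Finset.sum_nonneg fun i _ =>
          mul_nonneg (add_pos hσ (ih _ i.isLt)).le (Complex.normSq_nonneg _))
        (Finset.sum_nonneg fun k _ => mul_nonneg (hβ k) (Complex.normSq_nonneg _))
    exact pos_of_mul_pos_left (by linarith) hC'.le

lemma borderedForm_mono {n K : ℕ} (H : Matrix (Fin n) (Fin K) ℂ) (p : Fin K → ℂ)
    {d d' : Fin n → ℝ} {β β' : Fin K → ℝ} (hd : ∀ i, d i ≤ d' i) (hβ : ∀ k, β k ≤ β' k)
    (v : Fin n → ℂ) : borderedForm H p d β v ≤ borderedForm H p d' β' v :=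
  add_le_add
    (Finset.sum_le_sum fun i _ => mul_le_mul_of_nonneg_right (hd i) (Complex.normSq_nonneg _))
    (Finset.sum_le_sum fun k _ => mul_le_mul_of_nonneg_right (hβ k) (Complex.normSq_nonneg _))

lemma borderedForm_smul {n K : ℕ} (H : Matrix (Fin n) (Fin K) ℂ) (p : Fin K → ℂ)
    (α : ℝ) (d : Fin n → ℝ) (β : Fin K → ℝ) (v : Fin n → ℂ) :
    borderedForm H p (fun i => α * d i) (fun k => α * β k) v = α * borderedForm H p d β v := by
  simp only [borderedForm, mul_add, Finset.mul_sum, mul_assoc]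

lemma lam_mono {M K : ℕ} (h : Fin M → Fin K → ℂ) {σ2 : ℝ} (hσ : 0 < σ2)
    {C : Fin M → ℝ} (hC : ∀ m, 0 < C m) {β β' : Fin K → ℝ} (hβ : ∀ k, 0 ≤ β k)
    (hββ' : ∀ k, β k ≤ β' k) (m : Fin M) :
    lam M K h σ2 C β m ≤ lam M K h σ2 C β' m := by
  have hβ' : ∀ k, 0 ≤ β' k := fun k => (hβ k).trans (hββ' k)
  induction m using WellFoundedLT.induction with
  | ind m ih =>
    have hC' : 0 < (2 : ℝ) ^ C m - 1 := sub_pos.2 (Real.one_lt_rpow one_lt_two (hC m))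
    obtain ⟨v, hv⟩ := (isLeast_lamForm h hσ hC hβ' m fun i _ => lam_pos h hσ hC hβ' i).1
    have hle := (isLeast_lamForm h hσ hC hβ m fun i _ => lam_pos h hσ hC hβ i).2 ⟨v, rfl⟩
    have hQ : lamForm h σ2 C β m v ≤ lamForm h σ2 C β' m v :=
      borderedForm_mono _ _ (fun i => by linarith [ih (Fin.castLE m.isLt.le i) i.isLt]) hββ' v
    exact le_of_mul_le_mul_right (by linarith) hC'

lemma lam_smul_lt {M K : ℕ} (h : Fin M → Fin K → ℂ) {σ2 : ℝ} (hσ : 0 < σ2)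
    {C : Fin M → ℝ} (hC : ∀ m, 0 < C m) {β : Fin K → ℝ} (hβ : ∀ k, 0 ≤ β k)
    {α : ℝ} (hα : 1 < α) (m : Fin M) :
    lam M K h σ2 C (fun k => α * β k) m < α * lam M K h σ2 C β m := by
  have hαβ : ∀ k, 0 ≤ α * β k := fun k => mul_nonneg (by linarith) (hβ k)
  have hασ : σ2 < α * σ2 := lt_mul_of_one_lt_left hσ hα
  induction m using WellFoundedLT.induction with
  | ind m ih =>
    have hC' : 0 < (2 : ℝ) ^ C m - 1 := sub_pos.2 (Real.one_lt_rpow one_lt_two (hC m))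
    obtain ⟨v, hv⟩ := (isLeast_lamForm h hσ hC hβ m fun i _ => lam_pos h hσ hC hβ i).1
    have hle := (isLeast_lamForm h hσ hC hαβ m fun i _ => lam_pos h hσ hC hαβ i).2 ⟨v, rfl⟩
    have hQ : lamForm h σ2 C (fun k => α * β k) m v ≤ α * lamForm h σ2 C β m v := by
      rw [lamForm, lamForm, ← borderedForm_smul]
      refine borderedForm_mono _ _ (fun i => ?_) (fun _ => le_rfl) v
      rw [mul_add]
      exact add_le_add hασ.le (ih (Fin.castLE m.isLt.le i) i.isLt).le
    rw [hv] at hQ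
    refine lt_of_mul_lt_mul_right ?_ hC'.le
    linarith

/-- **Lemma 5** (properties of the recursively defined uplink quantization-noise map):
`λ(·)` is positive, strictly sub-homogeneous, and monotone on the nonnegative orthant. -/
theorem lam_map_properties
    (M K : ℕ) (h : Fin M → Fin K → ℂ) (σ2 : ℝ) (hσ : 0 < σ2)
    (C : Fin M → ℝ) (hC : ∀ m, 0 < C m)
    (β : Fin K → ℝ) (hβ : ∀ k, 0 ≤ β k) :
    (∀ m, 0 < lam M K h σ2 C β m) ∧
    (∀ α : ℝ, 1 < α → ∀ m,
      lam M K h σ2 C (fun k => α * β k) m < α * lam M K h σ2 C β m) ∧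
    (∀ βbar : Fin K → ℝ, (∀ k, 0 ≤ βbar k) → (∀ k, β k ≤ βbar k) →
      ∀ m, lam M K h σ2 C β m ≤ lam M K h σ2 C βbar m) := by
  exact ⟨lam_pos h hσ hC hβ, fun _ hα => lam_smul_lt h hσ hC hβ hα,
    fun _ _ hle => lam_mono h hσ hC hβ hle⟩

end Stmt19
end
end
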